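/- arXiv:quant-ph/0503239 — 3 statements merged into one kernel-verified Lean document; each statement's English description precedes it below -/
import Mathlib

section
/- Let p be an odd prime and 0 < r < 1 a real number. With φ_{a,b} = c_a · (r^{a·x} e_p(a x² + b x))_{x=0}^{p−1} ∈ ℂ^p for a, b ∈ {0, ..., p−1}, where c_a = (Σ_{x=0}^{p−1} r^{2 a x})^{-1/2}, let E_{a,b} = |φ_{a,b}⟩⟨φ_{a,b}| / p and G = Σ_{a,b=0}^{p−1} E_{a,b}. Then G is the diagonal matrix G = diag(Σ_{a=0}^{p−1} c_a² r^{2 a x} : x = 0, 1, ..., p−1). -/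
/-- `e_m(z) = exp(2 π i z / m)` for an integer `z`. -/
noncomputable def eInt (m : ℕ) (z : ℤ) : ℂ :=
  Complex.exp (2 * Real.pi * Complex.I * (z : ℂ) / m)

theorem eInt_add (m : ℕ) (z w : ℤ) : eInt m (z + w) = eInt m z * eInt m w := by
  simp only [eInt, ← Complex.exp_add]
  congr 1
  push_cast
  ring

theorem eInt_natCast_mul (m n : ℕ) (z : ℤ) : eInt m (n * z) = eInt m z ^ n := by
  simp only [eInt, ← Complex.exp_nat_mul]
  congr 1
  push_cast
  ring

theorem conj_eInt (m : ℕ) (z : ℤ) : (starRingEnd ℂ) (eInt m z) = eInt m (-z) := by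
  simp only [eInt, ← Complex.exp_conj]
  congr 1
  simp [Complex.conj_ofNat, neg_div]

theorem eInt_eq_one_iff {m : ℕ} (hm : m ≠ 0) (z : ℤ) : eInt m z = 1 ↔ (m : ℤ) ∣ z := by
  rw [← (Complex.isPrimitiveRoot_exp m hm).zpow_eq_one_iff_dvd, eInt, ← Complex.exp_int_mul]
  ring_nf

/-- Orthogonality of additive characters modulo `m`. -/
theorem sum_eInt_mul {m : ℕ} (hm : m ≠ 0) (z : ℤ) :
    ∑ b : Fin m, eInt m (b.val * z) = if (m : ℤ) ∣ z then (m : ℂ) else 0 := by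
  simp only [eInt_natCast_mul]
  rw [Fin.sum_univ_eq_sum_range (fun b => eInt m z ^ b)]
  split_ifs with h
  · simp [(eInt_eq_one_iff hm z).2 h]
  · have hz : eInt m z ^ m = 1 := by
      rw [← eInt_natCast_mul, eInt_eq_one_iff hm]
      exact dvd_mul_right _ _
    rw [geom_sum_eq (mt (eInt_eq_one_iff hm z).1 h), hz, sub_self, zero_div]

theorem Fin.natCast_dvd_val_sub_val_iff {m : ℕ} (x y : Fin m) :
    (m : ℤ) ∣ (x.val : ℤ) - y.val ↔ x = y := by
  rw [← Int.modEq_iff_dvd, Int.natCast_modEq_iff, Nat.ModEq, Nat.mod_eq_of_lt x.isLt,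
    Nat.mod_eq_of_lt y.isLt, Fin.ext_iff, eq_comm]

/-- For an odd prime `p`, `0 < r < 1`, perturbed vectors
`φ_{a,b} = c_a (r^{a·x} e_p(a x² + b x))_x` with `c_a = (Σ_x r^{2ax})^{-1/2}`,
`E_{a,b} = |φ_{a,b}⟩⟨φ_{a,b}|/p`, the frame operator `G = Σ_{a,b} E_{a,b}` is the
diagonal matrix `diag(Σ_a c_a² r^{2 a x} : x = 0, …, p−1)`. -/
theorem perturbed_mub_frame_operator_diagonal
    (p : ℕ) (hp : p.Prime) (hodd : p ≠ 2) (r : ℝ) (hr0 : 0 < r) (hr1 : r < 1)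
    (c : Fin p → ℝ)
    (hc : ∀ a, c a = 1 / Real.sqrt (∑ x : Fin p, r ^ (2 * a.val * x.val)))
    (φ : Fin p → Fin p → EuclideanSpace ℂ (Fin p))
    (hφ : ∀ a b x, φ a b x =
      (c a : ℂ) * (r : ℂ) ^ (a.val * x.val) *
        eInt p (a.val * x.val ^ 2 + b.val * x.val))
    (E : Fin p → Fin p → Matrix (Fin p) (Fin p) ℂ)
    (hE : ∀ a b, E a b = (p : ℂ)⁻¹ •
      (Matrix.of fun x y => φ a b x * (starRingEnd ℂ) (φ a b y)))
    (G : Matrix (Fin p) (Fin p) ℂ) (hG : G = ∑ a : Fin p, ∑ b : Fin p, E a b) :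
    G = Matrix.diagonal fun x : Fin p =>
      ((∑ a : Fin p, (c a) ^ 2 * r ^ (2 * a.val * x.val) : ℝ) : ℂ) := by
  have hp0 : p ≠ 0 := hp.ne_zero
  have hpC : (p : ℂ) ≠ 0 := Nat.cast_ne_zero.2 hp0
  have entry : ∀ a b x y, E a b x y =
      ((p : ℂ)⁻¹ * (c a : ℂ) ^ 2 * (r : ℂ) ^ (a.val * x.val) * (r : ℂ) ^ (a.val * y.val) *
        eInt p (a.val * ((x.val : ℤ) ^ 2 - y.val ^ 2))) *
        eInt p (b.val * ((x.val : ℤ) - y.val)) := by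
    intro a b x y
    have phase : eInt p (a.val * x.val ^ 2 + b.val * x.val) *
        eInt p (-(a.val * y.val ^ 2 + b.val * y.val)) =
        eInt p (a.val * ((x.val : ℤ) ^ 2 - y.val ^ 2)) *
          eInt p (b.val * ((x.val : ℤ) - y.val)) := by
      rw [← eInt_add, ← eInt_add]
      ring_nf
    simp only [hE, Matrix.smul_apply, Matrix.of_apply, hφ, map_mul, map_pow, Complex.conj_ofReal,
      conj_eInt, smul_eq_mul]
    linear_combination ((p : ℂ)⁻¹ * (c a : ℂ) ^ 2 * (r : ℂ) ^ (a.val * x.val) *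
      (r : ℂ) ^ (a.val * y.val)) * phase
  ext x y
  simp only [hG, Matrix.sum_apply, entry, ← Finset.mul_sum, sum_eInt_mul hp0,
    Fin.natCast_dvd_val_sub_val_iff, Matrix.diagonal_apply]
  split_ifs with hxy
  · subst hxy
    push_cast
    refine Finset.sum_congr rfl fun a _ => ?_
    rw [sub_self, mul_zero, (eInt_eq_one_iff hp0 0).2 (dvd_zero _), mul_assoc 2, two_mul, pow_add]
    field_simp
  · simp
end

section
/- For every ε > 0 there exists P such that for every odd prime p ≥ P the following holds with r = 1 − p^{-3}: defining φ_{a,b} = c_a · (r^{a·x} e_p(a x² + b x))_{x=0}^{p−1} ∈ ℂ^p for a, b ∈ {0, ..., p−1}, where c_a = (Σ_{x=0}^{p−1} r^{2 a x})^{-1/2}, one has |⟨φ_{a,b}, φ_{c,d}⟩| ≤ (1 + ε) p^{-1/2} for all pairs (a,b) ≠ (c,d). -/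
open scoped ComplexInnerProductSpace

/-- The quadratic exponential sum of a primitive additive character over a finite field of odd
characteristic has absolute value the square root of the order of the field. -/
theorem norm_sum_addChar_quadratic {R : Type*} [Field R] [Fintype R] {ψ : AddChar R ℂ}
    (hψ : ψ.IsPrimitive) {u : R} (v : R) (h2u : 2 * u ≠ 0) :
    ‖∑ x, ψ (u * x ^ 2 + v * x)‖ = Real.sqrt (Fintype.card R) := by
  classical
  rw [eq_comm, Real.sqrt_eq_iff_eq_sq (Nat.cast_nonneg _) (norm_nonneg _), eq_comm]
  have key : ((‖∑ x, ψ (u * x ^ 2 + v * x)‖ ^ 2 : ℝ) : ℂ) = Fintype.card R := by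
    push_cast
    rw [← Complex.mul_conj', map_sum, Finset.sum_mul_sum, Finset.sum_comm]
    calc ∑ y, ∑ x, ψ (u * x ^ 2 + v * x) * (starRingEnd ℂ) (ψ (u * y ^ 2 + v * y))
        = ∑ y, ∑ h, ψ (u * h ^ 2 + v * h) * ψ (y * (2 * u * h)) := by
          refine Finset.sum_congr rfl fun y _ => ?_
          rw [← Equiv.sum_comp (Equiv.addRight y)]
          refine Finset.sum_congr rfl fun h _ => ?_
          rw [← AddChar.map_neg_eq_conj, ← AddChar.map_add_eq_mul, ← AddChar.map_add_eq_mul,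
            Equiv.coe_addRight]
          congr 1
          ring
      _ = ∑ h, ψ (u * h ^ 2 + v * h) * if h = 0 then (Fintype.card R : ℂ) else 0 := by
          rw [Finset.sum_comm]
          refine Finset.sum_congr rfl fun h _ => ?_
          rw [← Finset.mul_sum, AddChar.sum_mulShift _ hψ]
          simp only [mul_eq_zero_iff_left h2u]
          split_ifs <;> simp
      _ = Fintype.card R := by simp
  exact_mod_cast key

theorem eInt_eq_stdAddChar (p : ℕ) [NeZero p] (z : ℤ) : eInt p z = ZMod.stdAddChar (z : ZMod p) :=
  (ZMod.stdAddChar_coe z).symm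

theorem norm_eInt (p : ℕ) [NeZero p] (z : ℤ) : ‖eInt p z‖ = 1 := by
  rw [eInt_eq_stdAddChar, AddChar.norm_apply]

theorem conj_eInt_mul_eInt (p : ℕ) [NeZero p] (z w : ℤ) :
    (starRingEnd ℂ) (eInt p z) * eInt p w = eInt p (w - z) := by
  rw [eInt_eq_stdAddChar, eInt_eq_stdAddChar, eInt_eq_stdAddChar, ← AddChar.map_neg_eq_conj,
    ← AddChar.map_add_eq_mul]
  congr 1
  push_cast
  ring

theorem ZMod.sum_fin_natCast {M : Type*} [AddCommMonoid M] (p : ℕ) [NeZero p] (f : ZMod p → M) :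
    ∑ x : Fin p, f (x.val : ZMod p) = ∑ x, f x := by
  refine Fintype.sum_bijective (fun x : Fin p => (x.val : ZMod p)) ?_ _ _ fun _ => rfl
  rw [Fintype.bijective_iff_injective_and_card]
  refine ⟨fun x y h => Fin.ext ?_, by simp⟩
  have := congrArg ZMod.val h
  simpa [ZMod.val_natCast_of_lt x.2, ZMod.val_natCast_of_lt y.2] using this

theorem intCast_sub_ne_zero_of_fin_ne {p : ℕ} {a a' : Fin p} (h : a ≠ a') :
    (((a'.val : ℤ) - a.val : ℤ) : ZMod p) ≠ 0 := by
  rw [Ne, ZMod.intCast_zmod_eq_zero_iff_dvd]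
  intro hd
  have := Int.eq_zero_of_abs_lt_dvd hd (by rw [abs_lt]; omega)
  exact h (Fin.ext (by omega))

/-- The unperturbed vectors in dimension an odd prime are mutually unbiased. -/
theorem norm_sum_eInt_quadratic_le {p : ℕ} (hp : p.Prime) (hp2 : p ≠ 2) {a b a' b' : Fin p}
    (h : (a, b) ≠ (a', b')) :
    ‖∑ x : Fin p, eInt p (((a'.val : ℤ) - a.val) * x.val ^ 2 + ((b'.val : ℤ) - b.val) * x.val)‖
      ≤ Real.sqrt p := by
  have : Fact p.Prime := ⟨hp⟩
  set u : ZMod p := (((a'.val : ℤ) - a.val : ℤ) : ZMod p) with hu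
  set v : ZMod p := (((b'.val : ℤ) - b.val : ℤ) : ZMod p) with hv
  have hsum : ∑ x : Fin p,
      eInt p (((a'.val : ℤ) - a.val) * x.val ^ 2 + ((b'.val : ℤ) - b.val) * x.val)
      = ∑ x : ZMod p, ZMod.stdAddChar (u * x ^ 2 + v * x) := by
    rw [← ZMod.sum_fin_natCast]
    refine Finset.sum_congr rfl fun x _ => ?_
    rw [eInt_eq_stdAddChar, hu, hv]
    push_cast
    rfl
  rw [hsum]
  by_cases haa : a = a'
  · have hv0 : v ≠ 0 := intCast_sub_ne_zero_of_fin_ne fun hb => h (by rw [haa, hb])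
    have hu0 : u = 0 := by simp [hu, haa]
    simp only [hu0, zero_mul, zero_add, mul_comm v]
    rw [AddChar.sum_mulShift _ (ZMod.isPrimitive_stdAddChar p), if_neg hv0]
    simp
  · have h2 : (2 : ZMod p) ≠ 0 := by
      refine Ring.two_ne_zero ?_
      rwa [ZMod.ringChar_zmod_n]
    rw [norm_sum_addChar_quadratic (ZMod.isPrimitive_stdAddChar p) v
      (mul_ne_zero h2 (intCast_sub_ne_zero_of_fin_ne haa)), ZMod.card]

theorem norm_sum_smul_le {ι : Type*} [Fintype ι] (w : ι → ℝ) (z : ι → ℂ) {δ : ℝ}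
    (hw : ∀ x, |w x - 1| ≤ δ) (hz : ∀ x, ‖z x‖ = 1) :
    ‖∑ x, (w x : ℂ) * z x‖ ≤ ‖∑ x, z x‖ + Fintype.card ι * δ := by
  have hsplit : ∑ x, (w x : ℂ) * z x = ∑ x, z x + ∑ x, ((w x - 1 : ℝ) : ℂ) * z x := by
    rw [← Finset.sum_add_distrib]
    refine Finset.sum_congr rfl fun x _ => ?_
    push_cast
    ring
  rw [hsplit]
  refine (norm_add_le _ _).trans (add_le_add_right ?_ _)
  refine (norm_sum_le _ _).trans ?_
  refine (Finset.sum_le_card_nsmul _ _ δ fun x _ => ?_).trans_eq (by simp)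
  rw [norm_mul, hz, mul_one, Complex.norm_real]
  exact hw x

theorem one_sub_two_div_le_pow {p k : ℕ} (hp : 0 < p) (hk : k ≤ 2 * p ^ 2) :
    1 - 2 / (p : ℝ) ≤ (1 - 1 / (p : ℝ) ^ 3) ^ k := by
  have hp1 : (1 : ℝ) ≤ p := by exact_mod_cast hp
  have hinv : 1 / (p : ℝ) ^ 3 ≤ 1 := by
    rw [div_le_one (by positivity)]
    exact one_le_pow₀ hp1
  have hk' : (k : ℝ) ≤ 2 * (p : ℝ) ^ 2 := by exact_mod_cast hk
  have hb := one_add_mul_le_pow (a := -(1 / (p : ℝ) ^ 3)) (by linarith) k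
  have hkp : (k : ℝ) * (1 / (p : ℝ) ^ 3) ≤ 2 / (p : ℝ) := by
    calc (k : ℝ) * (1 / (p : ℝ) ^ 3) ≤ 2 * (p : ℝ) ^ 2 * (1 / (p : ℝ) ^ 3) := by gcongr
      _ = 2 / (p : ℝ) := by field_simp
  rw [← sub_eq_add_neg] at hb
  linarith

theorem sqrt_add_two_div_sub_two_le {ε t : ℝ} (hε : 0 < ε) (ht : (4 / ε + 2) ^ 2 ≤ t) :
    (Real.sqrt t + 2) / (t - 2) ≤ (1 + ε) / Real.sqrt t := by
  have h0 : 0 < 4 / ε := by positivity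
  have hs : 4 / ε + 2 ≤ Real.sqrt t := Real.le_sqrt_of_sq_le ht
  have ht0 : 0 ≤ t := (sq_nonneg _).trans ht
  have hsq : Real.sqrt t ^ 2 = t := Real.sq_sqrt ht0
  set s := Real.sqrt t
  have hεs : 4 + 2 * ε ≤ ε * s := by
    calc 4 + 2 * ε = ε * (4 / ε + 2) := by field_simp
      _ ≤ ε * s := by gcongr
  rw [← hsq, div_le_div_iff₀ (by nlinarith) (by linarith)]
  nlinarith

/-- For every `ε > 0` there is `P` such that for every odd prime
`p ≥ P`, taking `r = 1 − p^{-3}` and the perturbed vectors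
`φ_{a,b} = c_a (r^{a·x} e_p(a x² + b x))_x` with `c_a = (Σ_x r^{2ax})^{-1/2}`,
all distinct pairs satisfy `|⟨φ_{a,b}, φ_{c,d}⟩| ≤ (1 + ε) p^{-1/2}`. -/
theorem perturbed_mub_approximate_symmetry
    (ε : ℝ) (hε : 0 < ε) :
    ∃ P : ℕ, ∀ p : ℕ, P ≤ p → p.Prime → p ≠ 2 →
      ∀ r : ℝ, r = 1 - 1 / (p : ℝ) ^ 3 →
      ∀ c : Fin p → ℝ,
        (∀ a, c a = 1 / Real.sqrt (∑ x : Fin p, r ^ (2 * a.val * x.val))) →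
      ∀ φ : Fin p → Fin p → EuclideanSpace ℂ (Fin p),
        (∀ a b x, φ a b x =
          (c a : ℂ) * (r : ℂ) ^ (a.val * x.val) *
            eInt p (a.val * x.val ^ 2 + b.val * x.val)) →
      ∀ a b a' b' : Fin p, (a, b) ≠ (a', b') →
        ‖⟪φ a b, φ a' b'⟫‖ ≤ (1 + ε) / Real.sqrt p := by
  refine ⟨⌈(4 / ε + 2) ^ 2⌉₊, ?_⟩
  rintro p hP hp hp2 r rfl c hc φ hφ a b a' b' hne
  have : NeZero p := ⟨hp.ne_zero⟩
  have hpos : 0 < p := hp.pos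
  have hp1 : (1 : ℝ) ≤ p := by exact_mod_cast hpos
  have hp3 : (2 : ℝ) < p := by exact_mod_cast lt_of_le_of_ne hp.two_le hp2.symm
  set r : ℝ := 1 - 1 / (p : ℝ) ^ 3 with hr
  have hprod (i x : Fin p) : i.val * x.val ≤ p ^ 2 := by
    rw [sq]
    exact Nat.mul_le_mul i.2.le x.2.le
  have hr0 : 0 ≤ r := by
    rw [hr, sub_nonneg, div_le_one (by positivity)]
    exact one_le_pow₀ hp1
  have hr1 : r ≤ 1 := by
    rw [hr, sub_le_self_iff]
    positivity
  have hc0 (i : Fin p) : 0 ≤ c i := by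
    rw [hc]
    positivity
  have hc1 (i : Fin p) : c i ≤ 1 / Real.sqrt (p - 2) := by
    rw [hc]
    have : (p : ℝ) - 2 ≤ ∑ x : Fin p, r ^ (2 * i.val * x.val) := by
      calc (p : ℝ) - 2 = ∑ _x : Fin p, (1 - 2 / (p : ℝ)) := by
            simp only [Finset.sum_const, Finset.card_univ, Fintype.card_fin, nsmul_eq_mul]
            field_simp
        _ ≤ _ := Finset.sum_le_sum fun x _ =>
            one_sub_two_div_le_pow hpos (by rw [mul_assoc]; exact Nat.mul_le_mul_left 2 (hprod i x))
    have : 0 < Real.sqrt (p - 2) := Real.sqrt_pos.2 (by linarith)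
    gcongr
  have hinner : ⟪φ a b, φ a' b'⟫ = ((c a * c a' : ℝ) : ℂ) *
      ∑ x : Fin p, ((r ^ (a.val * x.val + a'.val * x.val) : ℝ) : ℂ) *
        eInt p (((a'.val : ℤ) - a.val) * x.val ^ 2 + ((b'.val : ℤ) - b.val) * x.val) := by
    rw [PiLp.inner_apply, Finset.mul_sum]
    refine Finset.sum_congr rfl fun x _ => ?_
    rw [hφ, hφ, RCLike.inner_apply, show ((a'.val : ℤ) - a.val) * (x.val : ℤ) ^ 2
        + ((b'.val : ℤ) - b.val) * x.val = (a'.val * x.val ^ 2 + b'.val * x.val)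
        - (a.val * x.val ^ 2 + b.val * x.val) by ring, ← conj_eInt_mul_eInt]
    simp only [map_mul, map_pow, Complex.conj_ofReal]
    push_cast
    ring
  have hsum : ‖∑ x : Fin p, ((r ^ (a.val * x.val + a'.val * x.val) : ℝ) : ℂ) *
      eInt p (((a'.val : ℤ) - a.val) * x.val ^ 2 + ((b'.val : ℤ) - b.val) * x.val)‖
      ≤ Real.sqrt p + 2 := by
    refine (norm_sum_smul_le _ _ (δ := 2 / p) (fun x => ?_) fun x => norm_eInt p _).trans
      (add_le_add (norm_sum_eInt_quadratic_le hp hp2 hne) ?_)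
    · have hlow := one_sub_two_div_le_pow (k := a.val * x.val + a'.val * x.val) hpos
        (by have := hprod a x; have := hprod a' x; omega)
      have hup : r ^ (a.val * x.val + a'.val * x.val) ≤ 1 := pow_le_one₀ hr0 hr1
      rw [abs_sub_comm, abs_of_nonneg (by linarith)]
      linarith
    · rw [Fintype.card_fin]
      field_simp
      rfl
  have hcc : c a * c a' ≤ 1 / (p - 2) := by
    calc c a * c a' ≤ 1 / Real.sqrt (p - 2) * (1 / Real.sqrt (p - 2)) :=
          mul_le_mul (hc1 a) (hc1 a') (hc0 a') (by positivity)
      _ = 1 / (p - 2) := by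
          rw [div_mul_div_comm, one_mul, Real.mul_self_sqrt (by linarith)]
  rw [hinner, norm_mul, Complex.norm_real, Real.norm_of_nonneg (mul_nonneg (hc0 a) (hc0 a'))]
  calc c a * c a' * _ ≤ 1 / (p - 2) * (Real.sqrt p + 2) :=
        mul_le_mul hcc hsum (norm_nonneg _) (by
          have : (0 : ℝ) < p - 2 := by linarith
          positivity)
    _ = (Real.sqrt p + 2) / (p - 2) := by ring
    _ ≤ (1 + ε) / Real.sqrt p :=
        sqrt_add_two_div_sub_two_le hε ((Nat.le_ceil _).trans (by exact_mod_cast hP))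
end

section
/- For every integer d ≥ 2 there exists a constant C_d > 0 such that for every prime p > d, every polynomial F ∈ F_p[X] of degree exactly d, every positive integer n, and every integer k: |Σ_{u=1}^{p} e_p(F(u)) e_n(k u)| ≤ C_d · p^{2/3} if d = 2, and |Σ_{u=1}^{p} e_p(F(u)) e_n(k u)| ≤ C_d · p^{3/4} if d ≥ 3. -/
/-- `e_m(z) = exp(2 π i z / m)` for `z ∈ ZMod m` (represented by an integer in `[0, m-1]`). -/
noncomputable def eZMod (m : ℕ) (z : ZMod m) : ℂ :=
  Complex.exp (2 * Real.pi * Complex.I * (z.val : ℂ) / m)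

section PowerSums

open Polynomial

/-- The power sums of a finite family of elements, assembled into a power series. -/
noncomputable def powerSumSeries {R : Type*} [CommRing R] (s : Multiset R) : PowerSeries R :=
  PowerSeries.mk fun j => (s.map (· ^ j)).sum

theorem mk_pow_mul_one_sub {R : Type*} [CommRing R] (a : R) :
    PowerSeries.mk (fun j => a ^ j) * (1 - PowerSeries.C a * PowerSeries.X) = 1 := by
  ext n
  rw [mul_sub, mul_one, mul_left_comm, map_sub, PowerSeries.coeff_C_mul]
  cases n with
  | zero => simp
  | succ n => simp [PowerSeries.coeff_one, pow_succ']

theorem powerSumSeries_mul_prod {R : Type*} [CommRing R] (s : Multiset R) :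
    powerSumSeries s * (s.map fun a => 1 - PowerSeries.C a * PowerSeries.X).prod =
      (s.card : PowerSeries R) * (s.map fun a => 1 - PowerSeries.C a * PowerSeries.X).prod -
        PowerSeries.X * PowerSeries.derivative R
          (s.map fun a => 1 - PowerSeries.C a * PowerSeries.X).prod := by
  induction s using Multiset.induction_on with
  | empty => 
    have : powerSumSeries (0 : Multiset R) = 0 := by ext; simp [powerSumSeries]
    simp [this]
  | cons a s ih =>
    have h1 : powerSumSeries (a ::ₘ s) = PowerSeries.mk (fun j => a ^ j) + powerSumSeries s := by
      ext; simp [powerSumSeries]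
    have h2 := mk_pow_mul_one_sub a
    have h3 : PowerSeries.derivative R (1 - PowerSeries.C a * PowerSeries.X) =
        - PowerSeries.C a := by
      simp [PowerSeries.derivative_X, Derivation.leibniz, PowerSeries.derivative_C]
    rw [Multiset.map_cons, Multiset.prod_cons, Derivation.leibniz, h1, h3, Multiset.card_cons]
    simp only [smul_eq_mul]
    generalize (s.map fun a => 1 - PowerSeries.C a * PowerSeries.X).prod = G at *
    push_cast
    linear_combination G * h2 + (1 - PowerSeries.C a * PowerSeries.X) * ih

theorem reverse_prod_X_sub_C {K : Type*} [Field K] (s : Multiset K) :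
    (((s.map fun a => X - C a).prod.reverse : K[X]) : PowerSeries K) =
      (s.map fun a => 1 - PowerSeries.C a * PowerSeries.X).prod := by
  induction s using Multiset.induction_on with
  | empty =>
    have : (1 : K[X]).reverse = 1 := by rw [← C_1, reverse_C]
    simp [this]
  | cons a s ih =>
    rw [Multiset.map_cons, Multiset.prod_cons, reverse_mul_of_domain, Polynomial.coe_mul, ih,
      Multiset.map_cons, Multiset.prod_cons]
    congr 1
    have : (X - C a : K[X]).reverse = 1 - C a * X := by
      rw [sub_eq_add_neg, ← C_neg, reverse_add_C]
      have : (X : K[X]).reverse = 1 := by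
        have := reverse_X_mul (1 : K[X])
        rw [mul_one] at this
        rw [this, ← C_1, reverse_C]
      rw [this]; simp [sub_eq_add_neg]
    rw [this]
    simp

variable {k : Type*} [Field k]

/-- The series of power sums of the roots of a monic polynomial, read off from its coefficients. -/
noncomputable def newtonSeries (f : k[X]) : PowerSeries k :=
  (f.natDegree : PowerSeries k) -
    PowerSeries.X * PowerSeries.derivative k (f.reverse : PowerSeries k) *
      (f.reverse : PowerSeries k)⁻¹

theorem constantCoeff_reverse {f : k[X]} (hf : f.Monic) :
    PowerSeries.constantCoeff (f.reverse : PowerSeries k) = 1 := by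
  simp [hf.leadingCoeff]

theorem reverse_series_ne_zero {f : k[X]} (hf : f.Monic) :
    (f.reverse : PowerSeries k) ≠ 0 := by
  intro h
  have := constantCoeff_reverse hf
  simp [h] at this

theorem newtonSeries_mul_reverse {f : k[X]} (hf : f.Monic) :
    newtonSeries f * (f.reverse : PowerSeries k) =
      (f.natDegree : PowerSeries k) * (f.reverse : PowerSeries k) -
        PowerSeries.X * PowerSeries.derivative k (f.reverse : PowerSeries k) := by
  have h := PowerSeries.inv_mul_cancel (f.reverse : PowerSeries k)
    (by rw [constantCoeff_reverse hf]; exact one_ne_zero)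
  rw [newtonSeries, sub_mul, mul_assoc, h, mul_one]

theorem newtonSeries_mul {f g : k[X]} (hf : f.Monic) (hg : g.Monic) :
    newtonSeries (f * g) = newtonSeries f + newtonSeries g := by
  apply mul_right_cancel₀ (reverse_series_ne_zero (hf.mul hg))
  rw [newtonSeries_mul_reverse (hf.mul hg), reverse_mul_of_domain, Polynomial.coe_mul,
    Derivation.leibniz, hf.natDegree_mul hg]
  simp only [smul_eq_mul]
  push_cast
  linear_combination -(g.reverse : PowerSeries k) * newtonSeries_mul_reverse hf -
    (f.reverse : PowerSeries k) * newtonSeries_mul_reverse hg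

theorem newtonSeries_prod_X_sub_C (s : Multiset k) :
    newtonSeries (s.map fun a => X - C a).prod = powerSumSeries s := by
  have hm : (s.map fun a => X - C a).prod.Monic := monic_multiset_prod_of_monic _ _ fun a _ =>
    monic_X_sub_C a
  apply mul_right_cancel₀ (reverse_series_ne_zero hm)
  rw [newtonSeries_mul_reverse hm, reverse_prod_X_sub_C, powerSumSeries_mul_prod,
    natDegree_multiset_prod_X_sub_C_eq_card]

theorem map_newtonSeries {K : Type*} [Field K] (φ : k →+* K) {f : k[X]} (hf : f.Monic) :
    (newtonSeries f).map φ = newtonSeries (f.map φ) := by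
  apply mul_right_cancel₀ (reverse_series_ne_zero (hf.map φ))
  have hr : (f.map φ).reverse = f.reverse.map φ := by
    ext n
    simp [coeff_reverse]
  have hd : PowerSeries.derivative K ((f.reverse : PowerSeries k).map φ) =
      (PowerSeries.derivative k (f.reverse : PowerSeries k)).map φ := by
    ext n
    simp [PowerSeries.coeff_derivative]
  rw [newtonSeries_mul_reverse (hf.map φ), hr, Polynomial.natDegree_map,
    Polynomial.polynomial_map_coe, ← map_mul,
    newtonSeries_mul_reverse hf, hd]
  simp

/-- If `f` splits over `K`, the coefficients of `newtonSeries f` are the power sums of its roots. -/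
theorem map_coeff_newtonSeries {K : Type*} [Field K] (φ : k →+* K) {f : k[X]} (hf : f.Monic)
    {s : Multiset K} (hs : f.map φ = (s.map fun a => X - C a).prod) (j : ℕ) :
    φ (PowerSeries.coeff j (newtonSeries f)) = (s.map (· ^ j)).sum := by
  rw [← PowerSeries.coeff_map, map_newtonSeries φ hf, hs, newtonSeries_prod_X_sub_C,
    powerSumSeries, PowerSeries.coeff_mk]

theorem reverse_add_C_mul_X_pow {f : k[X]} {n d : ℕ} (hfn : f.natDegree = n)
    (hd : 0 < d) (hdn : d ≤ n) (c : k) :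
    (f + C c * X ^ (n - d)).reverse = f.reverse + C c * X ^ d := by
  have h1 : (f + C c * X ^ (n - d)).natDegree = n := by
    rw [natDegree_add_eq_left_of_natDegree_lt, hfn]
    exact lt_of_le_of_lt (natDegree_C_mul_X_pow_le _ _) (by omega)
  rw [reverse, h1, reverse, hfn, reflect_add, reflect_C_mul_X_pow]
  congr 3
  rw [revAt_le (by omega)]
  omega

theorem monic_add_C_mul_X_pow {f : k[X]} (hf : f.Monic) {n d : ℕ} (hfn : f.natDegree = n)
    (hd : 0 < d) (hdn : d ≤ n) (c : k) :
    (f + C c * X ^ (n - d)).Monic ∧ (f + C c * X ^ (n - d)).natDegree = n := by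
  have h : (C c * X ^ (n - d)).natDegree < f.natDegree :=
    lt_of_le_of_lt (natDegree_C_mul_X_pow_le _ _) (by omega)
  refine ⟨hf.add_of_left (degree_lt_degree h), ?_⟩
  rw [natDegree_add_eq_left_of_natDegree_lt h, hfn]

theorem newtonSeries_add_C_mul_X_pow {f : k[X]} (hf : f.Monic) {n d : ℕ} (hfn : f.natDegree = n)
    (hd : 0 < d) (hdn : d ≤ n) (c : k) :
    ∃ u : PowerSeries k, PowerSeries.constantCoeff u = 0 ∧
      newtonSeries (f + C c * X ^ (n - d)) = newtonSeries f +
        PowerSeries.X ^ d * (- PowerSeries.C (d * c) + u) := by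
  obtain ⟨hm, hn⟩ := monic_add_C_mul_X_pow hf hfn hd hdn c
  have h1 := newtonSeries_mul_reverse hm
  have h2 := newtonSeries_mul_reverse hf
  rw [hn, reverse_add_C_mul_X_pow hfn hd hdn] at h1
  rw [hfn] at h2
  set P := newtonSeries (f + C c * X ^ (n - d)) with hP
  have hP0 : PowerSeries.constantCoeff P = n := by
    rw [hP, newtonSeries, hn]; simp
  set g : PowerSeries k := (f.reverse : PowerSeries k) with hg
  have hg0 : PowerSeries.constantCoeff g = 1 := constantCoeff_reverse hf
  have hginv : g * g⁻¹ = 1 := PowerSeries.mul_inv_cancel _ (by rw [hg0]; exact one_ne_zero)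
  refine ⟨PowerSeries.C (d * c) + PowerSeries.C c * (n - d - P) * g⁻¹, ?_, ?_⟩
  · simp only [map_add, map_mul, map_sub, hP0, PowerSeries.constantCoeff_C, map_natCast,
      PowerSeries.constantCoeff_inv, hg0]
    simp; ring
  · have hder : PowerSeries.X * PowerSeries.derivative k
        ((f.reverse + C c * X ^ d : k[X]) : PowerSeries k) =
        PowerSeries.X * PowerSeries.derivative k g +
          PowerSeries.C c * (d : PowerSeries k) * PowerSeries.X ^ d := by
      obtain ⟨e, rfl⟩ : ∃ e, d = e + 1 := ⟨d - 1, by omega⟩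
      simp [Derivation.leibniz, Derivation.leibniz_pow, PowerSeries.derivative_X,
        PowerSeries.derivative_C, hg]
      ring
    rw [hder] at h1
    have h1' : P * (g + PowerSeries.C c * PowerSeries.X ^ d) =
      (n : PowerSeries k) * (g + PowerSeries.C c * PowerSeries.X ^ d) -
        (PowerSeries.X * PowerSeries.derivative k g +
          PowerSeries.C c * (d : PowerSeries k) * PowerSeries.X ^ d) := by
      simpa [hg] using h1
    have hg' : g ≠ 0 := reverse_series_ne_zero hf
    apply mul_right_cancel₀ hg'
    linear_combination h1' - h2 + (- PowerSeries.X ^ d * PowerSeries.C c * (n - d - P)) * hginv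

end PowerSums

section LFunction

open Polynomial

section Weight

variable {k : Type*} [Field k]

/-- The sum of the values of `F` at the roots of the monic polynomial `f`. -/
noncomputable def rootSum (F f : k[X]) : k :=
  ∑ j ∈ Finset.range (F.natDegree + 1), F.coeff j * PowerSeries.coeff j (newtonSeries f)

theorem rootSum_mul (F : k[X]) {f g : k[X]} (hf : f.Monic) (hg : g.Monic) :
    rootSum F (f * g) = rootSum F f + rootSum F g := by
  simp only [rootSum, newtonSeries_mul hf hg, map_add, mul_add, Finset.sum_add_distrib]

theorem rootSum_one (F : k[X]) : rootSum F 1 = 0 := by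
  have := rootSum_mul F (monic_one (R := k)) monic_one
  rw [one_mul] at this
  exact left_eq_add.mp this

theorem map_rootSum {K : Type*} [Field K] (φ : k →+* K) (F : k[X]) {f : k[X]} (hf : f.Monic)
    {s : Multiset K} (hs : f.map φ = (s.map fun a => X - C a).prod) :
    φ (rootSum F f) = (s.map fun a => (F.map φ).eval a).sum := by
  simp only [rootSum, map_sum, map_mul, map_coeff_newtonSeries φ hf hs]
  simp only [← Multiset.sum_map_mul_left]
  simp only [eval_eq_sum_range, natDegree_map, coeff_map]
  exact Multiset.sum_map_sum_map (Finset.range (F.natDegree + 1)).val s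

theorem rootSum_add_C_mul_X_pow (F : k[X]) {f : k[X]} (hf : f.Monic) {n : ℕ}
    (hfn : f.natDegree = n) (hd : 0 < F.natDegree) (hdn : F.natDegree ≤ n) (c : k) :
    rootSum F (f + C c * X ^ (n - F.natDegree)) =
      rootSum F f - F.leadingCoeff * F.natDegree * c := by
  obtain ⟨u, hu, h⟩ := newtonSeries_add_C_mul_X_pow hf hfn hd hdn c
  rw [rootSum, rootSum, h, Finset.sum_range_succ, Finset.sum_range_succ]
  have h1 : ∀ j ∈ Finset.range F.natDegree,
      F.coeff j * PowerSeries.coeff j (newtonSeries f + PowerSeries.X ^ F.natDegree *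
        (-PowerSeries.C (F.natDegree * c) + u)) =
      F.coeff j * PowerSeries.coeff j (newtonSeries f) := by
    intro j hj
    rw [map_add, PowerSeries.coeff_X_pow_mul', if_neg (by simpa using hj), add_zero]
  rw [Finset.sum_congr rfl h1, map_add, PowerSeries.coeff_X_pow_mul', if_pos le_rfl]
  simp [hu]
  ring

variable [Finite k]

theorem finite_setOf_monic_natDegree_eq (n : ℕ) :
    {f : k[X] | f.Monic ∧ f.natDegree = n}.Finite := by
  have : Finite (degreeLT k n) := Module.finite_of_finite k
  have : Finite {f : k[X] | f.Monic ∧ f.natDegree = n} :=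
    Finite.of_equiv _ (monicEquivDegreeLT n).symm
  exact Set.toFinite _

/-- The finite set of monic polynomials of degree `n` over a finite field. -/
noncomputable def monicFinset (k : Type*) [Field k] [Finite k] (n : ℕ) : Finset k[X] :=
  (finite_setOf_monic_natDegree_eq n).toFinset

theorem mem_monicFinset {n : ℕ} {f : k[X]} : f ∈ monicFinset k n ↔ f.Monic ∧ f.natDegree = n := by
  simp [monicFinset]

/-- The `n`-th coefficient of the `L`-function of the polynomial `F` and the character `ψ`. -/
noncomputable def lCoeff (ψ : AddChar k ℂ) (F : k[X]) (n : ℕ) : ℂ :=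
  ∑ f ∈ monicFinset k n, ψ (rootSum F f)

theorem lCoeff_zero (ψ : AddChar k ℂ) (F : k[X]) : lCoeff ψ F 0 = 1 := by
  have : monicFinset k 0 = {1} := by
    ext f
    rw [mem_monicFinset, Finset.mem_singleton]
    constructor
    · rintro ⟨h1, h2⟩
      exact h1.natDegree_eq_zero.mp h2
    · rintro rfl
      simp
  rw [lCoeff, this, Finset.sum_singleton, rootSum_one, AddChar.map_zero_eq_one]

theorem lCoeff_eq_zero {ψ : AddChar k ℂ} (hψ : ψ ≠ 1) {F : k[X]} (hF : (F.natDegree : k) ≠ 0)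
    {n : ℕ} (hn : F.natDegree ≤ n) : lCoeff ψ F n = 0 := by
  have hd : 0 < F.natDegree := Nat.pos_of_ne_zero fun h => hF (by simp [h])
  have hl : F.leadingCoeff ≠ 0 := by
    rw [Ne, leadingCoeff_eq_zero]; rintro rfl; simp at hd
  obtain ⟨b, hb⟩ := AddChar.ne_one_iff.mp hψ
  set c : k := - b / (F.leadingCoeff * F.natDegree) with hc
  have hbc : - (F.leadingCoeff * F.natDegree * c) = b := by
    rw [hc]; field_simp
  have h : lCoeff ψ F n = lCoeff ψ F n * ψ b := by
    rw [lCoeff, Finset.sum_mul]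
    symm
    refine Finset.sum_bij' (fun f _ => f + C c * X ^ (n - F.natDegree))
      (fun f _ => f + C (-c) * X ^ (n - F.natDegree)) ?_ ?_ ?_ ?_ ?_
    · intro f hf
      rw [mem_monicFinset] at hf ⊢
      exact monic_add_C_mul_X_pow hf.1 hf.2 hd hn c
    · intro f hf
      rw [mem_monicFinset] at hf ⊢
      exact monic_add_C_mul_X_pow hf.1 hf.2 hd hn _
    · intro f _
      simp
    · intro f _
      simp
    · intro f hf
      rw [mem_monicFinset] at hf
      rw [rootSum_add_C_mul_X_pow F hf.1 hf.2 hd hn c, sub_eq_add_neg, hbc,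
        AddChar.map_add_eq_mul]
  have h2 : lCoeff ψ F n * (ψ b - 1) = 0 := by linear_combination -h
  exact (mul_eq_zero.mp h2).resolve_right (sub_ne_zero.mpr hb)

end Weight

section Orbits

variable {p : ℕ} {K : Type*} [Field K]

/-- The product of `X - y` where `y` runs over the first `r` Frobenius iterates of `x`. -/
noncomputable def orbitProd (p : ℕ) (r : ℕ) (x : K) : K[X] :=
  ∏ i ∈ Finset.range r, (X - C (x ^ p ^ i))

theorem orbitProd_monic (r : ℕ) (x : K) : (orbitProd p r x).Monic :=
  monic_prod_of_monic _ _ fun _ _ => monic_X_sub_C _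

theorem natDegree_orbitProd (r : ℕ) (x : K) : (orbitProd p r x).natDegree = r := by
  rw [orbitProd, natDegree_prod_of_monic _ _ fun _ _ => monic_X_sub_C _]
  simp only [natDegree_X_sub_C, Finset.sum_const, Finset.card_range, smul_eq_mul, mul_one]

theorem X_sub_C_dvd_orbitProd {r : ℕ} (hr : 0 < r) (x : K) : X - C x ∣ orbitProd p r x := by
  have h := Finset.dvd_prod_of_mem (fun i => (X - C (x ^ p ^ i) : K[X])) (Finset.mem_range.mpr hr)
  rwa [pow_zero, pow_one] at h

theorem orbitProd_mul {m : ℕ} {x : K} (hx : x ^ p ^ m = x) (e : ℕ) :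
    orbitProd p (m * e) x = orbitProd p m x ^ e := by
  have hx' : ∀ e, x ^ p ^ (m * e) = x := by
    intro e
    induction e with
    | zero => simp
    | succ e ih => rw [mul_add, mul_one, pow_add, pow_mul, ih, hx]
  induction e with
  | zero => simp [orbitProd]
  | succ e ih =>
    rw [pow_succ, ← ih, mul_add, mul_one, orbitProd, Finset.prod_range_add, ← orbitProd]
    congr 1
    rw [orbitProd]
    refine Finset.prod_congr rfl fun i _ => ?_
    rw [pow_add, pow_mul, hx']

variable [Fact p.Prime]

variable (p K) in
/-- The elements of `K` fixed by the `r`-th power of Frobenius. -/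
noncomputable def fixFinset (r : ℕ) : Finset K :=
  open Classical in (X ^ p ^ r - X : K[X]).roots.toFinset

theorem mem_fixFinset {r : ℕ} (hr : 0 < r) {x : K} : x ∈ fixFinset p K r ↔ x ^ p ^ r = x := by
  have h1 : (X ^ p ^ r - X : K[X]) ≠ 0 :=
    FiniteField.X_pow_card_sub_X_ne_zero K (Nat.one_lt_pow hr.ne' (Fact.out : p.Prime).one_lt)
  simp [fixFinset, h1, sub_eq_zero]

section

variable [CharP K p]

theorem map_frobenius_orbitProd {r : ℕ} {x : K} (hx : x ^ p ^ r = x) :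
    (orbitProd p r x).map (frobenius K p) = orbitProd p r x := by
  have h : ∀ i, (X - C (x ^ p ^ i) : K[X]).map (frobenius K p) = X - C (x ^ p ^ (i + 1)) := by
    intro i
    rw [Polynomial.map_sub, map_X, map_C, frobenius_def, ← pow_mul, ← pow_succ]
  rw [orbitProd, Polynomial.map_prod, Finset.prod_congr rfl fun i _ => h i]
  apply mul_right_cancel₀ (b := X - C (x ^ p ^ 0)) (X_sub_C_ne_zero _)
  rw [← Finset.prod_range_succ' (fun i => X - C (x ^ p ^ i)), Finset.prod_range_succ, hx, pow_zero,
    pow_one]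

theorem iterate_frobenius_eq (x : K) (i : ℕ) : (frobenius K p)^[i] x = x ^ p ^ i :=
  (iterate_frobenius p i x)

end

variable [Algebra (ZMod p) K]

theorem exists_algebraMap_eq_of_pow_eq_self {a : K} (ha : a ^ p = a) :
    ∃ z : ZMod p, algebraMap (ZMod p) K z = a := by
  classical
  have h1 : (X ^ p - X : K[X]) ≠ 0 :=
    FiniteField.X_pow_card_sub_X_ne_zero K (Fact.out : p.Prime).one_lt
  have h2 : (Finset.univ : Finset (ZMod p)).image (algebraMap (ZMod p) K) =
      (X ^ p - X : K[X]).roots.toFinset := by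
    apply Finset.eq_of_subset_of_card_le
    · intro x hx
      obtain ⟨z, -, rfl⟩ := Finset.mem_image.mp hx
      simp [h1, ← map_pow, ZMod.pow_card]
    · rw [Finset.card_image_of_injective _ (algebraMap (ZMod p) K).injective, Finset.card_univ,
        ZMod.card]
      refine (Multiset.toFinset_card_le _).trans ((card_roots' _).trans ?_)
      rw [FiniteField.X_pow_card_sub_X_natDegree_eq K (Fact.out : p.Prime).one_lt]
  have h3 : a ∈ (X ^ p - X : K[X]).roots.toFinset := by simp [h1, ha]
  rw [← h2] at h3
  obtain ⟨z, -, hz⟩ := Finset.mem_image.mp h3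
  exact ⟨z, hz⟩

variable [CharP K p]

theorem exists_map_eq_of_map_frobenius_eq {g : K[X]} (hg : g.map (frobenius K p) = g) :
    ∃ f : (ZMod p)[X], f.map (algebraMap (ZMod p) K) = g := by
  rw [← mem_lifts, lifts_iff_coeff_lifts]
  intro n
  refine exists_algebraMap_eq_of_pow_eq_self ?_
  conv_rhs => rw [← hg]
  rw [coeff_map, frobenius_def]

theorem map_frobenius_map (f : (ZMod p)[X]) :
    (f.map (algebraMap (ZMod p) K)).map (frobenius K p) = f.map (algebraMap (ZMod p) K) := by
  ext n
  simp [frobenius_def, ← map_pow, ZMod.pow_card]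

open Classical in
/-- The descent of `orbitProd p r x` to the prime field, when `x` is fixed by the `r`-th power
of Frobenius. -/
noncomputable def orbitPoly (p : ℕ) [Fact p.Prime] [Algebra (ZMod p) K] (r : ℕ) (x : K) :
    (ZMod p)[X] :=
  if h : ∃ f : (ZMod p)[X], f.map (algebraMap (ZMod p) K) = orbitProd p r x then h.choose else 1

theorem map_orbitPoly {r : ℕ} {x : K} (hx : x ^ p ^ r = x) :
    (orbitPoly p r x).map (algebraMap (ZMod p) K) = orbitProd p r x := by
  have h := exists_map_eq_of_map_frobenius_eq (map_frobenius_orbitProd hx)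
  rw [orbitPoly, dif_pos h]
  exact h.choose_spec

theorem orbitPoly_monic {r : ℕ} {x : K} (hx : x ^ p ^ r = x) : (orbitPoly p r x).Monic := by
  apply monic_of_injective (algebraMap (ZMod p) K).injective
  rw [map_orbitPoly hx]
  exact orbitProd_monic r x

theorem natDegree_orbitPoly {r : ℕ} {x : K} (hx : x ^ p ^ r = x) :
    (orbitPoly p r x).natDegree = r := by
  rw [← natDegree_map (algebraMap (ZMod p) K), map_orbitPoly hx, natDegree_orbitProd]

theorem algebraMap_rootSum_orbitPoly (F : (ZMod p)[X]) {r : ℕ} {x : K} (hx : x ^ p ^ r = x) :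
    algebraMap (ZMod p) K (rootSum F (orbitPoly p r x)) =
      ∑ i ∈ Finset.range r, (F.map (algebraMap (ZMod p) K)).eval (x ^ p ^ i) := by
  rw [map_rootSum (algebraMap (ZMod p) K) F (orbitPoly_monic hx)
    (s := (Finset.range r).val.map fun i => x ^ p ^ i)]
  · rw [Multiset.map_map]; rfl
  · rw [map_orbitPoly hx, Multiset.map_map]; rfl

theorem rootMultiplicity_pow_pow (f : (ZMod p)[X]) (x : K) (i : ℕ) :
    rootMultiplicity (x ^ p ^ i) (f.map (algebraMap (ZMod p) K)) =
      rootMultiplicity x (f.map (algebraMap (ZMod p) K)) := by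
  induction i with
  | zero => simp
  | succ i ih =>
    rw [← ih, eq_rootMultiplicity_map (frobenius_inj K p) (x ^ p ^ i), map_frobenius_map,
      frobenius_def, pow_succ, pow_mul]

theorem orbitProd_dvd_iff {f : (ZMod p)[X]} (hf : f ≠ 0) {x : K}
    (hper : 0 < Function.minimalPeriod (frobenius K p) x) (e : ℕ) :
    orbitProd p (Function.minimalPeriod (frobenius K p) x * e) x ∣
        f.map (algebraMap (ZMod p) K) ↔
      e ≤ rootMultiplicity x (f.map (algebraMap (ZMod p) K)) := by
  set m := Function.minimalPeriod (frobenius K p) x with hm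
  have hf' : f.map (algebraMap (ZMod p) K) ≠ 0 := by
    rwa [Ne, Polynomial.map_eq_zero]
  have hx : x ^ p ^ m = x := by
    rw [← iterate_frobenius_eq]
    exact Function.isPeriodicPt_minimalPeriod _ _
  rw [orbitProd_mul hx]
  constructor
  · intro h
    rw [le_rootMultiplicity_iff hf']
    exact (pow_dvd_pow_of_dvd (X_sub_C_dvd_orbitProd hper x) e).trans h
  · intro h
    rw [orbitProd, ← Finset.prod_pow]
    apply Finset.prod_dvd_of_coprime
    · intro i hi j hj hij
      apply IsCoprime.pow
      apply isCoprime_X_sub_C_of_isUnit_sub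
      rw [isUnit_iff_ne_zero, sub_ne_zero]
      intro h
      rw [← iterate_frobenius_eq, ← iterate_frobenius_eq] at h
      exact hij (Function.iterate_injOn_Iio_minimalPeriod (by simpa using hi) (by simpa using hj) h)
    · intro i _
      rw [← le_rootMultiplicity_iff hf', rootMultiplicity_pow_pow]
      exact h

theorem minimalPeriod_frobenius_pos {f : (ZMod p)[X]} (hf : f ≠ 0) {x : K}
    (hx : x ∈ (f.map (algebraMap (ZMod p) K)).roots) :
    0 < Function.minimalPeriod (frobenius K p) x := by
  classical
  have hf' : f.map (algebraMap (ZMod p) K) ≠ 0 := by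
    rwa [Ne, Polynomial.map_eq_zero]
  have h : ∀ i : ℕ, x ^ p ^ i ∈ (f.map (algebraMap (ZMod p) K)).roots.toFinset := by
    intro i
    rw [Multiset.mem_toFinset, ← Multiset.count_pos, count_roots, rootMultiplicity_pow_pow,
      ← count_roots, Multiset.count_pos]
    exact hx
  obtain ⟨i, j, hij, heq⟩ := Finite.exists_ne_map_eq_of_infinite
    (fun i : ℕ => (⟨_, h i⟩ : (f.map (algebraMap (ZMod p) K)).roots.toFinset))
  have heq' : x ^ p ^ i = x ^ p ^ j := congrArg Subtype.val heq
  wlog hlt : j < i generalizing i j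
  · exact this j i hij.symm heq.symm heq'.symm (by omega)
  rw [← iterate_frobenius_eq, ← iterate_frobenius_eq] at heq'
  exact Function.IsPeriodicPt.minimalPeriod_pos (by omega : 0 < i - j)
    (Function.iterate_cancel (frobenius_inj K p) heq')

open Classical in
theorem sum_card_orbitPoly_dvd [IsAlgClosed K] {f : (ZMod p)[X]} (hf : f.Monic) :
    ∑ r ∈ Finset.Icc 1 f.natDegree, ((fixFinset p K r).filter fun x => orbitPoly p r x ∣ f).card =
      f.natDegree := by
  set fK := f.map (algebraMap (ZMod p) K) with hfK
  have hfK0 : fK ≠ 0 := (hf.map _).ne_zero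
  have hcard : fK.roots.card = f.natDegree := by
    rw [← natDegree_map (algebraMap (ZMod p) K)]
    exact (splits_iff_card_roots.mp (IsAlgClosed.splits fK))
  have hdvd : ∀ r x, x ^ p ^ r = x → (orbitPoly p r x ∣ f ↔ orbitProd p r x ∣ fK) := by
    intro r x hx
    rw [← map_orbitPoly hx, hfK, map_dvd_map']
  have h1 : ∀ r ∈ Finset.Icc 1 f.natDegree,
      (fixFinset p K r).filter (fun x => orbitPoly p r x ∣ f) =
        fK.roots.toFinset.filter fun x => x ^ p ^ r = x ∧ orbitProd p r x ∣ fK := by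
    intro r hr
    rw [Finset.mem_Icc] at hr
    ext x
    rw [Finset.mem_filter, Finset.mem_filter, mem_fixFinset hr.1, Multiset.mem_toFinset]
    constructor
    · rintro ⟨hx, h⟩
      rw [hdvd r x hx] at h
      refine ⟨?_, hx, h⟩
      rw [mem_roots hfK0, ← dvd_iff_isRoot]
      exact (X_sub_C_dvd_orbitProd hr.1 x).trans h
    · rintro ⟨-, hx, h⟩
      exact ⟨hx, (hdvd r x hx).mpr h⟩
  rw [Finset.sum_congr rfl fun r hr => congrArg Finset.card (h1 r hr)]
  simp only [Finset.card_filter]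
  rw [Finset.sum_comm, ← hcard]
  conv_rhs => rw [← Multiset.toFinset_sum_count_eq]
  refine Finset.sum_congr rfl fun x hx => ?_
  rw [Multiset.mem_toFinset] at hx
  have hper := minimalPeriod_frobenius_pos hf.ne_zero hx
  set m := Function.minimalPeriod (frobenius K p) x with hm
  rw [count_roots, ← Finset.card_filter]
  have h2 : (Finset.Icc 1 fK.roots.card).filter (fun r => x ^ p ^ r = x ∧ orbitProd p r x ∣ fK) =
      (Finset.Icc 1 (rootMultiplicity x fK)).image (fun e => m * e) := by
    ext r
    rw [Finset.mem_filter, Finset.mem_image, Finset.mem_Icc]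
    constructor
    · rintro ⟨⟨h1, h2⟩, h3, h4⟩
      obtain ⟨e, rfl⟩ : m ∣ r := by
        apply Function.IsPeriodicPt.minimalPeriod_dvd
        rw [← iterate_frobenius_eq] at h3
        exact h3
      refine ⟨e, Finset.mem_Icc.mpr ⟨?_, (orbitProd_dvd_iff hf.ne_zero hper e).mp h4⟩, rfl⟩
      exact Nat.pos_of_mul_pos_left h1
    · rintro ⟨e, he, rfl⟩
      rw [Finset.mem_Icc] at he
      have h4 := (orbitProd_dvd_iff hf.ne_zero hper e).mpr he.2
      refine ⟨⟨Nat.mul_pos hper he.1, ?_⟩, ?_, h4⟩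
      · rw [hcard, ← natDegree_map (algebraMap (ZMod p) K),
          ← natDegree_orbitProd (p := p) (m * e) x]
        exact natDegree_le_of_dvd h4 hfK0
      · rw [← iterate_frobenius_eq]
        exact (Function.isPeriodicPt_minimalPeriod _ _).mul_const e
  rw [h2, Finset.card_image_of_injective _ fun a b h => Nat.eq_of_mul_eq_mul_left hper h]
  simp

variable (K) in
/-- The character sum of `F` over the fixed field of the `r`-th power of Frobenius. -/
noncomputable def extSum (ψ : AddChar (ZMod p) ℂ) (F : (ZMod p)[X]) (r : ℕ) : ℂ :=
  ∑ x ∈ fixFinset p K r, ψ (rootSum F (orbitPoly p r x))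

theorem natCast_mul_lCoeff [IsAlgClosed K] (ψ : AddChar (ZMod p) ℂ) (F : (ZMod p)[X]) (n : ℕ) :
    n * lCoeff ψ F n = ∑ r ∈ Finset.Icc 1 n, extSum K ψ F r * lCoeff ψ F (n - r) := by
  classical
  have h1 : ∀ r ∈ Finset.Icc 1 n, extSum K ψ F r * lCoeff ψ F (n - r) =
      ∑ x ∈ fixFinset p K r, ∑ f ∈ monicFinset (ZMod p) n,
        if orbitPoly p r x ∣ f then ψ (rootSum F f) else 0 := by
    intro r hr
    rw [Finset.mem_Icc] at hr
    rw [extSum, Finset.sum_mul]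
    refine Finset.sum_congr rfl fun x hx => ?_
    rw [mem_fixFinset hr.1] at hx
    have hm := orbitPoly_monic hx
    rw [lCoeff, Finset.mul_sum, ← Finset.sum_filter]
    refine Finset.sum_bij (fun h _ => orbitPoly p r x * h) ?_ ?_ ?_ ?_
    · intro h hh
      rw [mem_monicFinset] at hh
      rw [Finset.mem_filter, mem_monicFinset]
      refine ⟨⟨hm.mul hh.1, ?_⟩, dvd_mul_right _ _⟩
      rw [hm.natDegree_mul hh.1, natDegree_orbitPoly hx, hh.2]
      omega
    · intro a _ b _ hab
      exact mul_left_cancel₀ hm.ne_zero hab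
    · intro f hf
      rw [Finset.mem_filter, mem_monicFinset] at hf
      obtain ⟨⟨hfm, hfn⟩, h, rfl⟩ := hf
      have hh : h.Monic := hm.of_mul_monic_left hfm
      refine ⟨h, mem_monicFinset.mpr ⟨hh, ?_⟩, rfl⟩
      rw [hm.natDegree_mul hh, natDegree_orbitPoly hx] at hfn
      omega
    · intro h hh
      rw [mem_monicFinset] at hh
      rw [rootSum_mul F hm hh.1, AddChar.map_add_eq_mul]
  rw [Finset.sum_congr rfl h1]
  simp_rw [Finset.sum_comm (t := monicFinset (ZMod p) n)]
  rw [lCoeff, Finset.mul_sum]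
  refine Finset.sum_congr rfl fun f hf => ?_
  rw [mem_monicFinset] at hf
  have h2 := sum_card_orbitPoly_dvd (K := K) hf.1
  rw [hf.2] at h2
  conv_lhs => rw [← h2]
  rw [Nat.cast_sum, Finset.sum_mul]
  refine Finset.sum_congr rfl fun r _ => ?_
  rw [← Finset.sum_filter, Finset.sum_const, nsmul_eq_mul]

/-- The character sums over the extensions are power sums of `deg F - 1` complex numbers. -/
theorem exists_extSum_eq [IsAlgClosed K] {ψ : AddChar (ZMod p) ℂ} (hψ : ψ ≠ 1) {F : (ZMod p)[X]}
    (hF : (F.natDegree : ZMod p) ≠ 0) :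
    ∃ s : Multiset ℂ, s.card = F.natDegree - 1 ∧
      ∀ r, 0 < r → extSum K ψ F r = - (s.map (· ^ r)).sum := by
  have hd : 0 < F.natDegree := Nat.pos_of_ne_zero fun h => hF (by simp [h])
  set N := F.natDegree - 1 with hN
  set L : ℂ[X] := ∑ n ∈ Finset.range (N + 1), C (lCoeff ψ F n) * X ^ n with hL
  have hLc : ∀ n, L.coeff n = lCoeff ψ F n := by
    intro n
    simp only [hL, finsetSum_coeff, coeff_C_mul_X_pow, Finset.sum_ite_eq, Finset.mem_range]
    split_ifs with h
    · rfl
    · rw [lCoeff_eq_zero hψ hF (by omega)]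
  have hLdeg : L.natDegree ≤ N := by
    rw [natDegree_le_iff_coeff_eq_zero]
    intro n hn
    rw [hLc, lCoeff_eq_zero hψ hF (by omega)]
  set Q : ℂ[X] := reflect N L with hQ
  have hQc : ∀ n ≤ N, Q.coeff n = L.coeff (N - n) := by
    intro n hn
    rw [hQ, coeff_reflect, revAt_le hn]
  have hQN : Q.coeff N = 1 := by
    rw [hQc N le_rfl, Nat.sub_self, hLc, lCoeff_zero]
  have hQdeg' : Q.natDegree ≤ N := by
    rw [natDegree_le_iff_coeff_eq_zero]
    intro n hn
    rw [hQ, coeff_reflect, revAt_eq_self_of_lt hn, coeff_eq_zero_of_natDegree_lt (by omega)]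
  have hQm : Q.Monic := monic_of_natDegree_le_of_coeff_eq_one N hQdeg' hQN
  have hQdeg : Q.natDegree = N :=
    le_antisymm hQdeg' (le_natDegree_of_ne_zero (by rw [hQN]; exact one_ne_zero))
  have hQrev : Q.reverse = L := by
    rw [reverse, hQdeg, hQ]
    ext n
    simp
  have hsplit := IsAlgClosed.splits Q
  have hprod : Q = (Q.roots.map fun a => X - C a).prod := by
    rw [← (hsplit.eq_prod_roots_of_monic hQm)]
  have hcard : Q.roots.card = N := by rw [splits_iff_card_roots.mp hsplit, hQdeg]
  refine ⟨Q.roots, hcard, ?_⟩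
  set S : PowerSeries ℂ := PowerSeries.mk fun r => if r = 0 then 0 else extSum K ψ F r with hS
  have hns : newtonSeries Q = powerSumSeries Q.roots := by
    conv_lhs => rw [hprod]
    rw [newtonSeries_prod_X_sub_C]
  have hmul := newtonSeries_mul_reverse hQm
  have hSL : S * (L : PowerSeries ℂ) =
      PowerSeries.X * PowerSeries.derivative ℂ (L : PowerSeries ℂ) := by
    ext n
    rw [PowerSeries.coeff_mul, Finset.Nat.sum_antidiagonal_eq_sum_range_succ_mk,
      Finset.sum_range_succ']
    have h := natCast_mul_lCoeff (K := K) ψ F n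
    have h2 : PowerSeries.coeff n (PowerSeries.X * PowerSeries.derivative ℂ (L : PowerSeries ℂ)) =
        n * lCoeff ψ F n := by
      cases n with
      | zero => simp
      | succ n =>
        rw [PowerSeries.coeff_succ_X_mul, PowerSeries.coeff_derivative, coeff_coe, hLc]
        push_cast
        ring
    have h3 : Finset.Icc 1 n = Finset.Ico 1 (n + 1) := by ext; simp
    rw [h2, h, h3, Finset.sum_Ico_eq_sum_range]
    simp [hS, hLc, add_comm]
  have hkey : newtonSeries Q = (N : PowerSeries ℂ) - S := by
    apply mul_right_cancel₀ (reverse_series_ne_zero hQm)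
    rw [hmul, hQrev, sub_mul, hSL, hQdeg]
  intro r hr
  have := congrArg (PowerSeries.coeff r) (hns.symm.trans hkey)
  have hNr : PowerSeries.coeff r (N : PowerSeries ℂ) = 0 := by
    rw [← map_natCast (PowerSeries.C (R := ℂ)), PowerSeries.coeff_C, if_neg hr.ne']
  rw [powerSumSeries, PowerSeries.coeff_mk, map_sub, hNr, hS, PowerSeries.coeff_mk,
    if_neg hr.ne'] at this
  rw [this]
  ring

end Orbits

end LFunction

section Stepanov

open Polynomial

section WeightFiltration

variable {k A : Type*} [Field k] [CommRing A] [Algebra k A] {p d : ℕ} {x y : A}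

variable (k p d x y) in
/-- The span of the monomials `x ^ i * y ^ j` of weight `p * i + d * j` less than `n`. -/
def weightLT (n : ℕ) : Submodule k A :=
  Submodule.span k {a | ∃ i j, p * i + d * j < n ∧ a = x ^ i * y ^ j}

theorem monomial_mem_weightLT {i j n : ℕ} (h : p * i + d * j < n) :
    x ^ i * y ^ j ∈ weightLT k p d x y n :=
  Submodule.subset_span ⟨i, j, h, rfl⟩

theorem weightLT_mono {m n : ℕ} (h : m ≤ n) : weightLT k p d x y m ≤ weightLT k p d x y n := by
  apply Submodule.span_mono
  rintro a ⟨i, j, hij, rfl⟩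
  exact ⟨i, j, hij.trans_le h, rfl⟩

theorem mul_mem_weightLT {a b : A} {m n : ℕ} (ha : a ∈ weightLT k p d x y (m + 1))
    (hb : b ∈ weightLT k p d x y n) : a * b ∈ weightLT k p d x y (m + n) := by
  have h := Submodule.mul_mem_mul ha hb
  rw [weightLT, weightLT, Submodule.span_mul_span] at h
  refine Submodule.span_mono ?_ h
  rintro _ ⟨_, ⟨i, j, hij, rfl⟩, _, ⟨i', j', hij', rfl⟩, rfl⟩
  exact ⟨i + i', j + j', by nlinarith, by simp only; ring⟩

theorem one_mem_weightLT : (1 : A) ∈ weightLT k p d x y 1 := by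
  simpa using monomial_mem_weightLT (k := k) (p := p) (d := d) (x := x) (y := y) (i := 0) (j := 0)
    (n := 1) (by simp)

theorem pow_mem_weightLT {a : A} {n : ℕ} (ha : a ∈ weightLT k p d x y (n + 1)) (m : ℕ) :
    a ^ m ∈ weightLT k p d x y (n * m + 1) := by
  induction m with
  | zero => simpa using one_mem_weightLT
  | succ m ih =>
    rw [pow_succ']
    exact weightLT_mono (by rw [mul_add]; omega) (mul_mem_weightLT ha ih)

theorem pow_sub_pow_mem_weightLT {a b : A} {n : ℕ} (hb : b ∈ weightLT k p d x y (n + 1))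
    (hab : a - b ∈ weightLT k p d x y n) (m : ℕ) :
    a ^ m - b ^ m ∈ weightLT k p d x y (n * m) := by
  have ha : a ∈ weightLT k p d x y (n + 1) := by
    have := add_mem (weightLT_mono (Nat.le_succ n) hab) hb
    rwa [sub_add_cancel] at this
  induction m with
  | zero => simp
  | succ m ih =>
    have h1 := mul_mem_weightLT ha ih
    have h2 := mul_mem_weightLT (pow_mem_weightLT hb m) hab
    have h3 : a ^ (m + 1) - b ^ (m + 1) = a * (a ^ m - b ^ m) + b ^ m * (a - b) := by ring
    rw [h3]
    exact add_mem (weightLT_mono (by rw [mul_add]; omega) h1)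
      (weightLT_mono (by rw [mul_add]; omega) h2)

theorem weightLT_le_span {F : k[X]} (hp1 : 1 < p) (hy : y ^ p = y + aeval x F)
    (hF : F.natDegree ≤ d) (n : ℕ) :
    weightLT k p d x y n ≤
      Submodule.span k {a | ∃ i j, j < p ∧ p * i + d * j < n ∧ a = x ^ i * y ^ j} := by
  rw [weightLT, Submodule.span_le]
  rintro _ ⟨i, j, hij, rfl⟩
  rw [SetLike.mem_coe]
  induction j using Nat.strong_induction_on generalizing i with
  | _ j ih =>
    by_cases hj : j < p
    · exact Submodule.subset_span ⟨i, j, hj, hij, rfl⟩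
    obtain ⟨e, rfl⟩ : ∃ e, j = e + p := ⟨j - p, by omega⟩
    have h1 : x ^ i * y ^ (e + p) =
        x ^ i * y ^ (e + 1) +
          ∑ t ∈ Finset.range (F.natDegree + 1), F.coeff t • (x ^ (i + t) * y ^ e) := by
      rw [pow_add y e p, hy, aeval_eq_sum_range, mul_add, mul_add, Finset.mul_sum,
        Finset.mul_sum]
      congr 1
      · ring
      · refine Finset.sum_congr rfl fun t _ => ?_
        rw [Algebra.mul_smul_comm, Algebra.mul_smul_comm]
        congr 1
        ring
    rw [h1]
    refine add_mem (ih _ (by omega) _ ?_) (Submodule.sum_mem _ fun t ht =>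
      Submodule.smul_mem _ _ (ih _ (by omega) _ ?_))
    · nlinarith
    · rw [Finset.mem_range] at ht
      have : p * t ≤ p * d := Nat.mul_le_mul_left _ (by omega)
      nlinarith

theorem weightLT_finite_finrank_le {F : k[X]} (hp : 1 < p) (hpd : p.Coprime d)
    (hy : y ^ p = y + aeval x F) (hF : F.natDegree ≤ d) (n : ℕ) :
    Module.Finite k (weightLT k p d x y n) ∧ Module.finrank k (weightLT k p d x y n) ≤ n := by
  classical
  set T : Finset (ℕ × ℕ) := (Finset.range n ×ˢ Finset.range p).filter
    fun ij => p * ij.1 + d * ij.2 < n with hT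
  set S : Finset A := T.image fun ij => x ^ ij.1 * y ^ ij.2 with hS
  have hle : weightLT k p d x y n ≤ Submodule.span k (S : Set A) := by
    refine (weightLT_le_span hp hy hF n).trans (Submodule.span_mono ?_)
    rintro _ ⟨i, j, hj, hij, rfl⟩
    rw [Finset.mem_coe, hS, Finset.mem_image]
    refine ⟨(i, j), ?_, rfl⟩
    rw [hT, Finset.mem_filter, Finset.mem_product, Finset.mem_range, Finset.mem_range]
    exact ⟨⟨by nlinarith, hj⟩, hij⟩
  have hcard : S.card ≤ n := by
    refine Finset.card_image_le.trans ?_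
    rw [← Finset.card_range n]
    refine Finset.card_le_card_of_injOn (fun ij => p * ij.1 + d * ij.2) ?_ ?_
    · intro ij hij
      simpa using (Finset.mem_filter.mp hij).2
    · rintro ⟨i, j⟩ hij ⟨i', j'⟩ hij' h
      simp only [hT, Finset.coe_filter, Set.mem_ofPred_eq, Finset.mem_product,
        Finset.mem_range] at hij hij' h
      have h1 : d * j ≡ d * j' [MOD p] := by
        have := congrArg (· % p) h
        simpa [Nat.ModEq, Nat.add_mod] using this
      have h2 : j ≡ j' [MOD p] := Nat.ModEq.cancel_left_of_coprime hpd h1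
      have h3 : j = j' := Nat.ModEq.eq_of_lt_of_lt h2 hij.1.2 hij'.1.2
      subst h3
      have : p * i = p * i' := by omega
      rw [Nat.eq_of_mul_eq_mul_left (by omega) this]
  have hfin : Module.Finite k (Submodule.span k (S : Set A)) :=
    FiniteDimensional.span_finset k S
  refine ⟨Submodule.finiteDimensional_of_le hle, ?_⟩
  exact (Submodule.finrank_mono hle).trans ((finrank_span_finset_le_card S).trans hcard)

theorem monomial_mul_pow_sub_mem {F : k[X]} (hp : 1 < p) (hd : 0 < d)
    (hy : y ^ p = y + aeval x F) (hF : F.natDegree = d) (i j i' j' Q : ℕ) :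
    x ^ i * y ^ j * (x ^ i' * y ^ j') ^ (p * Q) -
      (F.leadingCoeff ^ (Q * j')) • (x ^ (i + p * Q * i' + d * Q * j') * y ^ j) ∈
        weightLT k p d x y (p * i + d * j + p * Q * (p * i' + d * j')) := by
  have hb : F.leadingCoeff • x ^ d ∈ weightLT k p d x y (p * d + 1) := by
    apply Submodule.smul_mem
    simpa using monomial_mem_weightLT (k := k) (p := p) (d := d) (x := x) (y := y) (i := d)
      (j := 0) (n := p * d + 1) (by simp)
  have hab : y ^ p - F.leadingCoeff • x ^ d ∈ weightLT k p d x y (p * d) := by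
    rw [hy, aeval_eq_sum_range, Finset.sum_range_succ, hF, leadingCoeff, hF, ← add_assoc,
      add_sub_cancel_right]
    refine add_mem ?_ (Submodule.sum_mem _ fun t ht => Submodule.smul_mem _ _ ?_)
    · simpa using monomial_mem_weightLT (k := k) (p := p) (d := d) (x := x) (y := y) (i := 0)
        (j := 1) (n := p * d) (by nlinarith)
    · rw [Finset.mem_range] at ht
      simpa using monomial_mem_weightLT (k := k) (p := p) (d := d) (x := x) (y := y) (i := t)
        (j := 0) (n := p * d) (by nlinarith)
  have h1 := pow_sub_pow_mem_weightLT hb hab (Q * j')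
  have h2 : x ^ (i + p * Q * i') * y ^ j ∈
      weightLT k p d x y (p * (i + p * Q * i') + d * j + 1) :=
    monomial_mem_weightLT (Nat.lt_succ_self _)
  have h3 := mul_mem_weightLT h2 h1
  have h4 : x ^ (i + p * Q * i') * y ^ j *
      ((y ^ p) ^ (Q * j') - (F.leadingCoeff • x ^ d) ^ (Q * j')) =
      x ^ i * y ^ j * (x ^ i' * y ^ j') ^ (p * Q) -
      (F.leadingCoeff ^ (Q * j')) • (x ^ (i + p * Q * i' + d * Q * j') * y ^ j) := by
    rw [_root_.smul_pow, mul_sub, Algebra.mul_smul_comm]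
    congr 1
    · ring
    · congr 1
      ring
  rw [h4] at h3
  refine weightLT_mono (le_of_eq ?_) h3
  ring

end WeightFiltration

theorem exists_weight_eq {p d : ℕ} (hp : p.Prime) (hpd : p.Coprime d) {w : ℕ} (hw : d * p ≤ w) :
    ∃ i j, j < p ∧ p * i + d * j = w := by
  have : Fact p.Prime := ⟨hp⟩
  have hd : (d : ZMod p) ≠ 0 := by
    rw [Ne, ZMod.natCast_eq_zero_iff]
    exact (Nat.Prime.coprime_iff_not_dvd hp).mp hpd
  set j := ((w : ZMod p) * (d : ZMod p)⁻¹).val with hj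
  have hjp : j < p := ZMod.val_lt _
  have hjw : d * j ≤ w := (Nat.mul_le_mul_left d hjp.le).trans hw
  have h : p ∣ w - d * j := by
    rw [← ZMod.natCast_eq_zero_iff, Nat.cast_sub hjw, Nat.cast_mul, hj, ZMod.natCast_zmod_val]
    field_simp
    simp
  obtain ⟨i, hi⟩ := h
  exact ⟨i, j, hjp, by omega⟩

section Curve

variable {p : ℕ} [Fact p.Prime] (F : (ZMod p)[X])

/-- The equation `Y ^ p - Y = F` of an Artin-Schreier curve. -/
noncomputable def curvePoly : (ZMod p)[X][X] := X ^ p - (X + C F)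

theorem degree_X_add_C_lt : (X + C F : (ZMod p)[X][X]).degree < p := by
  rw [degree_X_add_C]
  exact_mod_cast (Fact.out : p.Prime).one_lt

theorem curvePoly_monic : (curvePoly F).Monic :=
  monic_X_pow_sub (degree_X_add_C_lt F)

theorem degree_curvePoly : (curvePoly F).degree = p := by
  rw [curvePoly, degree_sub_eq_left_of_degree_lt, degree_X_pow]
  rw [degree_X_pow]
  exact degree_X_add_C_lt F

/-- The affine coordinate ring of the Artin-Schreier curve `Y ^ p - Y = F`. -/
abbrev CurveRing := AdjoinRoot (curvePoly F)

/-- The first coordinate function on the Artin-Schreier curve. -/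
noncomputable def curveX : CurveRing F := AdjoinRoot.of (curvePoly F) X

/-- The second coordinate function on the Artin-Schreier curve. -/
noncomputable def curveY : CurveRing F := AdjoinRoot.root (curvePoly F)

theorem aeval_curveX (G : (ZMod p)[X]) : aeval (curveX F) G = AdjoinRoot.of (curvePoly F) G := by
  have : aeval (curveX F) G = (AdjoinRoot.of (curvePoly F)) (aeval X G) := by
    rw [curveX]
    exact (Polynomial.aeval_algHom_apply (AdjoinRoot.ofAlgHom (ZMod p) (curvePoly F)) X G)
  rw [this, aeval_X_left_apply]

theorem curveY_pow : curveY F ^ p = curveY F + aeval (curveX F) F := by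
  have h := AdjoinRoot.eval₂_root (curvePoly F)
  rw [curvePoly] at h
  simp only [eval₂_sub, eval₂_add, eval₂_pow, eval₂_X, eval₂_C] at h
  rw [aeval_curveX, curveY]
  exact sub_eq_zero.mp h

/-- The coefficient of `x ^ i * y ^ j` in the reduced form of a function on the curve. -/
noncomputable def curveCoeff (i j : ℕ) : CurveRing F →ₗ[ZMod p] ZMod p :=
  (lcoeff (ZMod p) i) ∘ₗ ((lcoeff (ZMod p)[X] j).restrictScalars (ZMod p)) ∘ₗ
    ((AdjoinRoot.modByMonicHom (curvePoly_monic F)).restrictScalars (ZMod p))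

theorem curveCoeff_apply (i j : ℕ) (a : CurveRing F) :
    curveCoeff F i j a = ((AdjoinRoot.modByMonicHom (curvePoly_monic F) a).coeff j).coeff i := rfl

theorem curveCoeff_monomial {i j i' j' : ℕ} (hj' : j' < p) :
    curveCoeff F i j (curveX F ^ i' * curveY F ^ j') = if i = i' ∧ j = j' then 1 else 0 := by
  have h : curveX F ^ i' * curveY F ^ j' =
      AdjoinRoot.mk (curvePoly F) (C (X ^ i') * X ^ j') := by
    rw [map_mul, map_pow C, map_pow, map_pow, AdjoinRoot.mk_C, AdjoinRoot.mk_X]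
    rfl
  rw [curveCoeff_apply, h, AdjoinRoot.modByMonicHom_mk,
    (modByMonic_eq_self_iff (curvePoly_monic F)).mpr, coeff_C_mul_X_pow]
  · split_ifs with h1 h2 h2 <;> simp_all [coeff_X_pow]
  · rw [degree_curvePoly]
    refine (degree_C_mul_X_pow_le _ _).trans_lt ?_
    exact_mod_cast hj'

theorem curveCoeff_eq_zero {d i j n : ℕ} (hF : F.natDegree ≤ d) (h : n ≤ p * i + d * j)
    {a : CurveRing F} (ha : a ∈ weightLT (ZMod p) p d (curveX F) (curveY F) n) :
    curveCoeff F i j a = 0 := by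
  have h1 := weightLT_le_span (Fact.out : p.Prime).one_lt (curveY_pow F) hF n ha
  suffices hle : Submodule.span (ZMod p) {a | ∃ i j, j < p ∧ p * i + d * j < n ∧
      a = curveX F ^ i * curveY F ^ j} ≤ LinearMap.ker (curveCoeff F i j) from
    LinearMap.mem_ker.mp (hle h1)
  rw [Submodule.span_le]
  rintro _ ⟨i', j', hj', hij', rfl⟩
  rw [SetLike.mem_coe, LinearMap.mem_ker, curveCoeff_monomial F hj', if_neg]
  rintro ⟨rfl, rfl⟩
  omega

variable {K : Type*} [Field K] [Algebra (ZMod p) K]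

/-- Evaluation of functions at a point of the curve. -/
noncomputable def curveEval {x y : K} (h : y ^ p = y + aeval x F) : CurveRing F →ₐ[ZMod p] K :=
  AdjoinRoot.liftAlgHom (curvePoly F) (aeval x) y (by
    rw [curvePoly]
    simp only [eval₂_sub, eval₂_add, eval₂_pow, eval₂_X, eval₂_C]
    rw [h]
    simp)

theorem curveEval_X {x y : K} (h : y ^ p = y + aeval x F) : curveEval F h (curveX F) = x := by
  simp [curveEval, curveX]

theorem curveEval_Y {x y : K} (h : y ^ p = y + aeval x F) : curveEval F h (curveY F) = y := by
  simp [curveEval, curveY]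

theorem curveEval_eq {x y : K} (h : y ^ p = y + aeval x F) (a : CurveRing F) :
    curveEval F h a =
      ((AdjoinRoot.modByMonicHom (curvePoly_monic F) a).map
        (aeval x : (ZMod p)[X] →ₐ[ZMod p] K).toRingHom).eval y := by
  conv_lhs => rw [← AdjoinRoot.mk_leftInverse (curvePoly_monic F) a]
  rw [eval_map, curveEval]
  simp

end Curve

end Stepanov

section StepanovBound

open Polynomial

variable {p : ℕ} [Fact p.Prime]

/-- On the curve, let `e u` be the monomial of weight `g + u`, and let `f u` be the same monomial
with `Y` replaced by `Y + a`. Then some nontrivial combination of the products `e u ^ Q * f v`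
vanishes. -/
theorem exists_frobenius_relation {F : (ZMod p)[X]} {g Q : ℕ} (hpd : p.Coprime F.natDegree)
    (hQ : g * g + 3 * g + 1 < Q) {I J : ℕ → ℕ}
    (hIJ : ∀ u, p * I u + F.natDegree * J u = g + u) (a : ZMod p) :
    ∃ c : Fin (Q - g) × Fin (Q + g + 1) → ZMod p, c ≠ 0 ∧
      ∑ u, c u • ((curveX F ^ I u.1 * curveY F ^ J u.1) ^ Q *
        (curveX F ^ I u.2 * (curveY F + algebraMap (ZMod p) (CurveRing F) a) ^ J u.2)) = 0 := by
  set d := F.natDegree with hd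
  have hp : 1 < p := (Fact.out : p.Prime).one_lt
  obtain ⟨hfin, hrank⟩ := weightLT_finite_finrank_le hp hpd (curveY_pow F) hd.ge
    (Q * Q + 2 * g + 1)
  set M := weightLT (ZMod p) p d (curveX F) (curveY F) with hM
  have hd0 : 0 < d := by
    rcases Nat.eq_zero_or_pos d with h | h
    · rw [h, Nat.coprime_zero_right] at hpd
      omega
    · exact h
  have hmem : ∀ u : Fin (Q - g) × Fin (Q + g + 1),
      (curveX F ^ I u.1 * curveY F ^ J u.1) ^ Q *
        (curveX F ^ I u.2 * (curveY F + algebraMap (ZMod p) (CurveRing F) a) ^ J u.2) ∈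
          M (Q * Q + 2 * g + 1) := by
    intro u
    have h1 : curveX F ^ I u.1 * curveY F ^ J u.1 ∈ M (g + u.1 + 1) :=
      monomial_mem_weightLT (by rw [hIJ]; omega)
    have h2 := pow_mem_weightLT h1 Q
    have h3 : curveX F ^ I u.2 ∈ M (p * I u.2 + 1) := by
      simpa using monomial_mem_weightLT (k := ZMod p) (p := p) (d := d) (x := curveX F)
        (y := curveY F) (i := I u.2) (j := 0) (n := p * I u.2 + 1) (by simp)
    have h4 : curveY F + algebraMap (ZMod p) (CurveRing F) a ∈ M (d + 1) := by
      refine add_mem ?_ ?_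
      · simpa using monomial_mem_weightLT (k := ZMod p) (p := p) (d := d) (x := curveX F)
          (y := curveY F) (i := 0) (j := 1) (n := d + 1) (by simp)
      · rw [Algebra.algebraMap_eq_smul_one]
        exact Submodule.smul_mem _ _ (weightLT_mono (by omega) one_mem_weightLT)
    have h5 := mul_mem_weightLT h2 (mul_mem_weightLT h3 (pow_mem_weightLT h4 (J u.2)))
    refine weightLT_mono ?_ h5
    have h6 := hIJ u.2
    have h7 := u.1.isLt
    have h8 := u.2.isLt
    have h9 : (g + u.1 + 1) * Q ≤ Q * Q := Nat.mul_le_mul_right _ (by omega)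
    have h10 : (g + u.1) * Q + Q = (g + u.1 + 1) * Q := by ring
    omega
  have hnot : ¬ LinearIndependent (ZMod p) (fun u : Fin (Q - g) × Fin (Q + g + 1) =>
      (⟨_, hmem u⟩ : M (Q * Q + 2 * g + 1))) := by
    intro hli
    have h1 := hli.fintype_card_le_finrank
    rw [Fintype.card_prod, Fintype.card_fin, Fintype.card_fin] at h1
    have h2 := h1.trans hrank
    obtain ⟨t, rfl⟩ : ∃ t, Q = g + t := ⟨Q - g, by omega⟩
    rw [Nat.add_sub_cancel_left] at h2
    nlinarith
  obtain ⟨c, hc, u, hu⟩ := Fintype.not_linearIndependent_iff.mp hnot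
  refine ⟨c, fun h => hu (by rw [h]; rfl), ?_⟩
  have := congrArg Subtype.val hc
  simpa using this

theorem exists_curveCoeff_ne_zero {F : (ZMod p)[X]} {g Q Q₁ : ℕ} (hd : 0 < F.natDegree)
    (hQ : Q = p * Q₁) {I J : ℕ → ℕ} (hJ : ∀ u, J u < p)
    (hIJ : ∀ u, p * I u + F.natDegree * J u = g + u)
    {c : Fin (Q - g) × Fin (Q + g + 1) → ZMod p} (hc : c ≠ 0) :
    ∃ i j, curveCoeff F i j (∑ u, c u • (curveX F ^ I u.1 * curveY F ^ J u.1 *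
      (curveX F ^ I u.2 * curveY F ^ J u.2) ^ Q)) ≠ 0 := by
  classical
  have hp : 1 < p := (Fact.out : p.Prime).one_lt
  set d := F.natDegree with hd'
  set W : Fin (Q - g) × Fin (Q + g + 1) → ℕ := fun u => (g + u.1) + Q * (g + u.2) with hW
  have hWinj : Function.Injective W := by
    rintro ⟨u, u'⟩ ⟨v, v'⟩ h
    simp only [hW] at h
    have h1 := u.isLt
    have h2 := v.isLt
    have hQ0 : 0 < Q := by omega
    have h3 : g + (u : ℕ) = g + v := by
      have := congrArg (· % Q) h
      simpa [Nat.add_mul_mod_self_left, Nat.mod_eq_of_lt (by omega : g + (u : ℕ) < Q),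
        Nat.mod_eq_of_lt (by omega : g + (v : ℕ) < Q)] using this
    have h4 : Q * (g + u') = Q * (g + v') := by omega
    have h5 := Nat.eq_of_mul_eq_mul_left hQ0 h4
    have h6 : u = v := Fin.ext (by omega)
    have h7 : u' = v' := Fin.ext (by omega)
    rw [h6, h7]
  obtain ⟨u₀, hu₀⟩ := Function.ne_iff.mp hc
  obtain ⟨m, hm, hmax⟩ := Finset.exists_max_image (Finset.univ.filter fun u => c u ≠ 0) W
    ⟨u₀, by simpa using hu₀⟩
  have hcm : c m ≠ 0 := (Finset.mem_filter.mp hm).2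
  have hweight : p * (I m.1 + Q * I m.2 + d * Q₁ * J m.2) + d * J m.1 = W m := by
    simp only [hW]
    rw [← hIJ m.1, ← hIJ m.2]
    have hQ' : p * (d * Q₁ * J m.2) = Q * (d * J m.2) := by
      rw [show p * (d * Q₁ * J m.2) = p * Q₁ * (d * J m.2) by ring, ← hQ]
    rw [mul_add, mul_add, hQ']
    ring
  refine ⟨I m.1 + Q * I m.2 + d * Q₁ * J m.2, J m.1, ?_⟩
  rw [map_sum, Finset.sum_eq_single m]
  · have h1 := monomial_mul_pow_sub_mem hp hd (curveY_pow F) rfl (I m.1) (J m.1) (I m.2) (J m.2) Q₁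
    rw [← hQ] at h1
    have h2 := curveCoeff_eq_zero F (d := d) (i := I m.1 + Q * I m.2 + d * Q₁ * J m.2)
      (j := J m.1) le_rfl
      (le_of_eq (by rw [hweight, hIJ, hIJ])) h1
    rw [map_sub, map_smul, curveCoeff_monomial F (hJ _), if_pos ⟨rfl, rfl⟩, sub_eq_zero] at h2
    rw [map_smul, h2, smul_eq_mul, smul_eq_mul, mul_one]
    refine mul_ne_zero hcm (pow_ne_zero _ ?_)
    rw [Ne, leadingCoeff_eq_zero]
    rintro rfl
    simp [hd'] at hd
  · intro u _ hum
    rw [map_smul]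
    by_cases hcu : c u = 0
    · rw [hcu, zero_smul]
    have hlt : W u < W m :=
      lt_of_le_of_ne (hmax u (by simpa using hcu)) fun h => hum (hWinj h)
    rw [curveCoeff_eq_zero F (d := d) (n := W m) le_rfl hweight.ge, smul_zero]
    refine weightLT_mono hlt ?_
    have h1 : curveX F ^ I u.1 * curveY F ^ J u.1 ∈
        weightLT (ZMod p) p d (curveX F) (curveY F) (g + u.1 + 1) :=
      monomial_mem_weightLT (by rw [hIJ]; omega)
    have h2 : curveX F ^ I u.2 * curveY F ^ J u.2 ∈
        weightLT (ZMod p) p d (curveX F) (curveY F) (g + u.2 + 1) :=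
      monomial_mem_weightLT (by rw [hIJ]; omega)
    refine weightLT_mono (le_of_eq ?_) (mul_mem_weightLT h1 (pow_mem_weightLT h2 Q))
    simp only [hW, Nat.succ_eq_add_one]
    ring
  · simp

variable {K : Type*} [Field K] [CharP K p]

theorem pow_pow_eq_add_sum {y b : K} (h : y ^ p = y + b) (n : ℕ) :
    y ^ p ^ n = y + ∑ i ∈ Finset.range n, b ^ p ^ i := by
  induction n with
  | zero => simp
  | succ n ih =>
    rw [pow_succ', pow_mul, h, add_pow_char_pow, ih, Finset.sum_range_succ, add_assoc]

variable [Algebra (ZMod p) K]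

theorem add_algebraMap_pow_pow (y : K) (c : ZMod p) (n : ℕ) :
    (y + algebraMap (ZMod p) K c) ^ p ^ n = y ^ p ^ n + algebraMap (ZMod p) K c := by
  rw [add_pow_char_pow, ← map_pow, ZMod.pow_card_pow]

theorem aeval_pow_pow (F : (ZMod p)[X]) (x : K) (n : ℕ) :
    aeval (x ^ p ^ n) F = (aeval x F) ^ p ^ n := by
  rw [aeval_eq_sum_range, aeval_eq_sum_range, sum_pow_char_pow]
  refine Finset.sum_congr rfl fun i _ => ?_
  rw [_root_.smul_pow, ZMod.pow_card_pow, ← pow_mul, ← pow_mul, mul_comm]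

/-- If a combination as in `exists_frobenius_relation`, with `Q = p ^ s`, vanishes, then the
combination of the `e u * e v ^ Q` with the same coefficients vanishes at the points `(x, y)` with
`x ^ (Q * Q) = x` and `y ^ (Q * Q) = y + a`. -/
theorem curveEval_eq_zero {F : (ZMod p)[X]} {ι : Type*} [Fintype ι] {c : ι → ZMod p}
    {i j i' j' : ι → ℕ} {a : ZMod p} {s : ℕ}
    (hc : ∑ u, c u • ((curveX F ^ i u * curveY F ^ j u) ^ p ^ s *
        (curveX F ^ i' u * (curveY F + algebraMap (ZMod p) (CurveRing F) a) ^ j' u)) = 0)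
    {x y : K} (h : y ^ p = y + aeval x F) (hx : x ^ p ^ (2 * s) = x)
    (hy : y ^ p ^ (2 * s) = y + algebraMap (ZMod p) K a) :
    curveEval F h (∑ u, c u • (curveX F ^ i u * curveY F ^ j u *
      (curveX F ^ i' u * curveY F ^ j' u) ^ p ^ s)) = 0 := by
  have h1 := congrArg (curveEval F h) hc
  apply eq_zero_of_pow_eq_zero (n := p ^ s)
  rw [map_sum, sum_pow_char_pow]
  rw [map_sum, map_zero] at h1
  rw [← h1]
  refine Finset.sum_congr rfl fun u _ => ?_
  simp only [map_smul, map_mul, map_pow, map_add, curveEval_X, curveEval_Y, AlgHom.commutes]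
  rw [_root_.smul_pow, ZMod.pow_card_pow, mul_pow _ _ (p ^ s),
    ← pow_mul (x ^ i' u * y ^ j' u), ← pow_add, ← two_mul,
    mul_pow _ _ (p ^ (2 * s)), ← pow_mul x, mul_comm (i' u), pow_mul x, hx,
    ← pow_mul y, mul_comm (j' u), pow_mul y, hy]

theorem card_rootSum_orbitPoly_eq_le [IsAlgClosed K] [DecidableEq K] {F : (ZMod p)[X]}
    (hpd : p.Coprime F.natDegree)
    {g s : ℕ} (hg : g = F.natDegree * p) (hs : 0 < s) (hQ : g * g + 3 * g + 1 < p ^ s)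
    (a : ZMod p) :
    p * ((fixFinset p K (2 * s)).filter fun x => rootSum F (orbitPoly p (2 * s) x) = a).card ≤
      p ^ s * p ^ s + (2 * g + 1) * p ^ s := by
  have hpp : p.Prime := Fact.out
  have hp : 1 < p := hpp.one_lt
  have hd0 : 0 < F.natDegree := by
    rcases Nat.eq_zero_or_pos F.natDegree with h | h
    · rw [h, Nat.coprime_zero_right] at hpd
      omega
    · exact h
  obtain ⟨Q₁, hQ₁⟩ : ∃ Q₁, p ^ s = p * Q₁ := dvd_pow_self p hs.ne'
  have hex : ∀ u, ∃ i j, j < p ∧ p * i + F.natDegree * j = g + u := fun u =>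
    exists_weight_eq hpp hpd (by omega)
  choose I J hJ hIJ using hex
  obtain ⟨c, hc0, hc⟩ := exists_frobenius_relation hpd hQ hIJ a
  obtain ⟨i₀, j₀, hne⟩ : ∃ i j, curveCoeff F i j
      (∑ u, c u • (curveX F ^ I u.1 * curveY F ^ J u.1 *
        (curveX F ^ I u.2 * curveY F ^ J u.2) ^ p ^ s)) ≠ 0 :=
    exists_curveCoeff_ne_zero hd0 hQ₁ hJ hIJ hc0
  set H := ∑ u, c u • (curveX F ^ I u.1 * curveY F ^ J u.1 *
    (curveX F ^ I u.2 * curveY F ^ J u.2) ^ p ^ s) with hH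
  set Q := p ^ s with hQdef
  have hHmem : H ∈ weightLT (ZMod p) p F.natDegree (curveX F) (curveY F)
      (Q * Q + (2 * g + 1) * Q + 1) := by
    refine Submodule.sum_mem _ fun u _ => Submodule.smul_mem _ _ ?_
    have h1 : curveX F ^ I u.1 * curveY F ^ J u.1 ∈
        weightLT (ZMod p) p F.natDegree (curveX F) (curveY F) (g + u.1 + 1) :=
      monomial_mem_weightLT (by rw [hIJ]; omega)
    have h2 : curveX F ^ I u.2 * curveY F ^ J u.2 ∈
        weightLT (ZMod p) p F.natDegree (curveX F) (curveY F) (g + u.2 + 1) :=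
      monomial_mem_weightLT (by rw [hIJ]; omega)
    refine weightLT_mono ?_ (mul_mem_weightLT h1 (pow_mem_weightLT h2 Q))
    have h3 := u.1.isLt
    have h4 := u.2.isLt
    have h5 : (g + u.2) * Q ≤ (Q + 2 * g) * Q := Nat.mul_le_mul_right _ (by omega)
    have h6 : (Q + 2 * g) * Q + Q = Q * Q + (2 * g + 1) * Q := by ring
    omega
  set P := AdjoinRoot.modByMonicHom (curvePoly_monic F) H with hP
  have hr0 : P.coeff j₀ ≠ 0 := by
    intro h
    rw [curveCoeff_apply, ← hP, h, coeff_zero] at hne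
    exact hne rfl
  have hdeg : p * (P.coeff j₀).natDegree ≤ Q * Q + (2 * g + 1) * Q := by
    by_contra hlt
    have h1 := curveCoeff_eq_zero F (i := (P.coeff j₀).natDegree) (j := j₀) le_rfl (by omega) hHmem
    rw [curveCoeff_apply, ← hP, coeff_natDegree, leadingCoeff_eq_zero] at h1
    exact hr0 h1
  refine le_trans (Nat.mul_le_mul_left _ ?_) hdeg
  have hr0' : (P.coeff j₀).map (algebraMap (ZMod p) K) ≠ 0 := by
    rwa [Ne, Polynomial.map_eq_zero]
  refine le_trans (Finset.card_le_card
    (t := ((P.coeff j₀).map (algebraMap (ZMod p) K)).roots.toFinset) ?_)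
    ((Multiset.toFinset_card_le _).trans ((card_roots' _).trans natDegree_map_le))
  intro x hx
  rw [Finset.mem_filter, mem_fixFinset (by omega)] at hx
  obtain ⟨hx, hxa⟩ := hx
  rw [Multiset.mem_toFinset, mem_roots hr0', IsRoot.def, eval_map_algebraMap]
  have htr := algebraMap_rootSum_orbitPoly F hx
  simp only [eval_map_algebraMap, aeval_pow_pow] at htr
  rw [hxa] at htr
  obtain ⟨y, hy⟩ : ∃ y : K, y ^ p = y + aeval x F := by
    obtain ⟨y, hy⟩ := IsAlgClosed.exists_root (X ^ p - (X + C (aeval x F)) : K[X]) (by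
      rw [degree_sub_eq_left_of_degree_lt, degree_X_pow]
      · exact_mod_cast hpp.ne_zero
      · rw [degree_X_pow, degree_X_add_C]
        exact_mod_cast hp)
    refine ⟨y, ?_⟩
    simpa [sub_eq_zero] using hy
  have hzero : P.map (aeval x : (ZMod p)[X] →ₐ[ZMod p] K).toRingHom = 0 := by
    refine eq_zero_of_degree_lt_of_eval_index_eq_zero (s := (Finset.univ : Finset (ZMod p)))
      (v := fun c => y + algebraMap (ZMod p) K c) ?_ ?_ ?_
    · intro b _ c _ hbc
      exact (algebraMap (ZMod p) K).injective (add_left_cancel hbc)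
    · rw [Finset.card_univ, ZMod.card, ← degree_curvePoly F]
      refine degree_map_le.trans_lt ?_
      rw [hP, ← AdjoinRoot.mk_leftInverse (curvePoly_monic F) H, AdjoinRoot.modByMonicHom_mk]
      exact degree_modByMonic_lt _ (curvePoly_monic F)
    · intro b _
      have hyb : (y + algebraMap (ZMod p) K b) ^ p =
          y + algebraMap (ZMod p) K b + aeval x F := by
        have := add_algebraMap_pow_pow y b 1
        rw [pow_one] at this
        rw [this, hy]
        ring
      rw [← curveEval_eq F hyb]
      refine curveEval_eq_zero hc hyb hx ?_
      rw [pow_pow_eq_add_sum hyb, htr]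
  have := congrArg (fun R => R.coeff j₀) hzero
  simpa using this

end StepanovBound

section WeilBound

open Polynomial

variable {p : ℕ} [Fact p.Prime] {K : Type*} [Field K] [CharP K p]

theorem le_card_fixFinset [IsAlgClosed K] {r : ℕ} (hr : 0 < r) :
    p ^ r ≤ (fixFinset p K r).card := by
  classical
  have hp : 1 < p := (Fact.out : p.Prime).one_lt
  have hq : 1 < p ^ r := Nat.one_lt_pow hr.ne' hp
  have hsep : (X ^ p ^ r - X : K[X]).Separable :=
    galois_poly_separable p _ (dvd_pow_self p hr.ne')
  have hcard : (X ^ p ^ r - X : K[X]).roots.card = p ^ r := by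
    rw [IsAlgClosed.card_roots_eq_natDegree, FiniteField.X_pow_card_sub_X_natDegree_eq K hq]
  calc p ^ r = (X ^ p ^ r - X : K[X]).roots.toFinset.card := by
        rw [Multiset.toFinset_card_of_nodup (nodup_roots hsep), hcard]
    _ ≤ _ := by
        refine Finset.card_le_card fun x hx => ?_
        rw [Multiset.mem_toFinset, mem_roots (FiniteField.X_pow_card_sub_X_ne_zero K hq)] at hx
        rw [mem_fixFinset hr]
        simpa [sub_eq_zero] using hx

theorem norm_extSum_le [Algebra (ZMod p) K] [IsAlgClosed K] {ψ : AddChar (ZMod p) ℂ} (hψ : ψ ≠ 1)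
    {F : (ZMod p)[X]} (hpd : p.Coprime F.natDegree) {g s : ℕ} (hg : g = F.natDegree * p)
    (hs : 0 < s) (hQ : g * g + 3 * g + 1 < p ^ s) :
    ‖extSum K ψ F (2 * s)‖ ≤ (2 * g + 1) * (p : ℝ) ^ s := by
  classical
  set A := fixFinset p K (2 * s) with hA
  set N : ZMod p → ℕ := fun a =>
    (A.filter fun x => rootSum F (orbitPoly p (2 * s) x) = a).card with hN
  set U : ℝ := (p ^ s * p ^ s + (2 * g + 1) * p ^ s) / p with hU
  have hp : (0 : ℝ) < p := by exact_mod_cast (Fact.out : p.Prime).pos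
  have hNU : ∀ a, (N a : ℝ) ≤ U := by
    intro a
    rw [hU, le_div_iff₀' hp]
    exact_mod_cast card_rootSum_orbitPoly_eq_le (K := K) hpd hg hs hQ a
  have hsum : ((p : ℝ) ^ s * p ^ s) ≤ ∑ a, (N a : ℝ) := by
    have h1 := le_card_fixFinset (p := p) (K := K) (r := 2 * s) (by omega)
    rw [← hA, Finset.card_eq_sum_card_fiberwise (t := Finset.univ)
      (f := fun x => rootSum F (orbitPoly p (2 * s) x)) (by simp)] at h1
    rw [← pow_add, ← two_mul]
    exact_mod_cast h1
  have hext : extSum K ψ F (2 * s) = -∑ a, ψ a * ((U - N a : ℝ) : ℂ) := by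
    have h1 : extSum K ψ F (2 * s) = ∑ a, ψ a * N a := by
      rw [extSum, ← Finset.sum_fiberwise_of_maps_to (t := Finset.univ)
        (g := fun x => rootSum F (orbitPoly p (2 * s) x)) (by simp)]
      refine Finset.sum_congr rfl fun a _ => ?_
      rw [Finset.sum_congr rfl (g := fun _ => ψ a), Finset.sum_const, nsmul_eq_mul, mul_comm]
      intro x hx
      rw [(Finset.mem_filter.mp hx).2]
    rw [h1]
    push_cast
    simp only [mul_sub, Finset.sum_sub_distrib, ← Finset.sum_mul,
      AddChar.sum_eq_zero_of_ne_one hψ]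
    ring
  rw [hext, norm_neg]
  calc ‖∑ a, ψ a * ((U - N a : ℝ) : ℂ)‖ ≤ ∑ a, (U - N a) := by
        refine (norm_sum_le _ _).trans (Finset.sum_le_sum fun a _ => le_of_eq ?_)
        rw [norm_mul, AddChar.norm_apply, one_mul, Complex.norm_real, Real.norm_eq_abs,
          abs_of_nonneg (sub_nonneg.mpr (hNU a))]
    _ = p * U - ∑ a, (N a : ℝ) := by
        rw [Finset.sum_sub_distrib, Finset.sum_const, Finset.card_univ, ZMod.card, nsmul_eq_mul]
    _ ≤ _ := by
        rw [hU, mul_div_cancel₀ _ hp.ne']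
        linarith

theorem norm_le_of_norm_powerSum_le {t : Multiset ℂ} {C R : ℝ} (hR : 0 < R) {n₀ : ℕ}
    (h : ∀ n, n₀ ≤ n → ‖(t.map (· ^ n)).sum‖ ≤ C * R ^ n) {β : ℂ} (hβ : β ∈ t) : ‖β‖ ≤ R := by
  classical
  set P : ℂ[X] := ∏ γ ∈ t.toFinset.erase β, (X - Polynomial.C γ) with hP
  have hPβ : P.eval β ≠ 0 := by
    rw [hP, eval_prod, Finset.prod_ne_zero_iff]
    intro γ hγ
    simpa [sub_eq_zero] using (Finset.ne_of_mem_erase hγ).symm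
  have hPγ : ∀ γ ∈ t.toFinset, γ ≠ β → P.eval γ = 0 := by
    intro γ hγ hne
    rw [hP, eval_prod]
    exact Finset.prod_eq_zero (Finset.mem_erase.mpr ⟨hne, hγ⟩) (by simp)
  have key : ∀ n, t.count β * (β ^ n * P.eval β) =
      ∑ j ∈ Finset.range (P.natDegree + 1), P.coeff j * (t.map (· ^ (n + j))).sum := by
    intro n
    have h1 : (t.map fun γ => γ ^ n * P.eval γ).sum = t.count β * (β ^ n * P.eval β) := by
      rw [Finset.sum_multiset_map_count, Finset.sum_eq_single β, nsmul_eq_mul]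
      · intro γ hγ hne
        rw [hPγ γ hγ hne, mul_zero, smul_zero]
      · intro hn
        exact absurd (Multiset.mem_toFinset.mpr hβ) hn
    rw [← h1]
    simp_rw [eval_eq_sum_range, Finset.mul_sum, ← Multiset.sum_map_mul_left]
    rw [Multiset.sum_map_sum]
    refine Finset.sum_congr rfl fun j _ => congrArg _ (Multiset.map_congr rfl fun γ _ => ?_)
    ring
  set D : ℝ := ∑ j ∈ Finset.range (P.natDegree + 1), ‖P.coeff j‖ * (C * R ^ j) with hD
  have hcount : (1 : ℝ) ≤ t.count β := by exact_mod_cast Multiset.one_le_count_iff_mem.mpr hβ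
  have hbound : ∀ n, n₀ ≤ n → ‖P.eval β‖ * ‖β‖ ^ n ≤ D * R ^ n := by
    intro n hn
    calc ‖P.eval β‖ * ‖β‖ ^ n ≤ ‖(t.count β * (β ^ n * P.eval β) : ℂ)‖ := by
          rw [norm_mul, norm_mul, norm_pow, Complex.norm_natCast]
          have : 0 ≤ ‖β‖ ^ n * ‖P.eval β‖ := by positivity
          nlinarith
      _ ≤ D * R ^ n := by
          rw [key, hD, Finset.sum_mul]
          refine (norm_sum_le _ _).trans (Finset.sum_le_sum fun j _ => ?_)
          rw [norm_mul, mul_assoc, mul_assoc, ← pow_add, add_comm j]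
          exact mul_le_mul_of_nonneg_left (h _ (by omega)) (norm_nonneg _)
  by_contra! hlt
  have h1 : 1 < ‖β‖ / R := (one_lt_div hR).mpr hlt
  have h2 := tendsto_pow_atTop_atTop_of_one_lt h1
  obtain ⟨n, hn, hn'⟩ := ((h2.eventually_gt_atTop (D / ‖P.eval β‖)).and
    (Filter.eventually_ge_atTop n₀)).exists
  have h3 := hbound n hn'
  rw [div_pow, div_lt_div_iff₀ (by positivity) (by positivity)] at hn
  linarith

theorem extSum_one [Algebra (ZMod p) K] (ψ : AddChar (ZMod p) ℂ) (F : (ZMod p)[X]) :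
    extSum K ψ F 1 = ∑ u, ψ (F.eval u) := by
  symm
  rw [extSum]
  refine Finset.sum_bij (fun u _ => algebraMap (ZMod p) K u) ?_ ?_ ?_ ?_
  · intro u _
    rw [mem_fixFinset one_pos, pow_one, ← map_pow, ZMod.pow_card]
  · intro u _ v _ h
    exact (algebraMap (ZMod p) K).injective h
  · intro x hx
    rw [mem_fixFinset one_pos, pow_one] at hx
    obtain ⟨z, hz⟩ := exists_algebraMap_eq_of_pow_eq_self hx
    exact ⟨z, Finset.mem_univ _, hz⟩
  · intro u _
    congr 1
    apply (algebraMap (ZMod p) K).injective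
    rw [algebraMap_rootSum_orbitPoly F (by rw [pow_one, ← map_pow, ZMod.pow_card])]
    simp [eval_map_algebraMap, aeval_algebraMap_apply]

/-- **Weil's bound** for additive character sums of polynomials. -/
theorem norm_sum_addChar_eval_le {ψ : AddChar (ZMod p) ℂ} (hψ : ψ ≠ 1) {F : (ZMod p)[X]}
    (hF : 0 < F.natDegree) (hFp : F.natDegree < p) :
    ‖∑ u, ψ (F.eval u)‖ ≤ (F.natDegree - 1) * √p := by
  have hpp : p.Prime := Fact.out
  have hp : (0 : ℝ) < p := by exact_mod_cast hpp.pos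
  have hpd : p.Coprime F.natDegree :=
    (Nat.Prime.coprime_iff_not_dvd hpp).mpr fun h => (Nat.le_of_dvd hF h).not_gt hFp
  have : CharP (AlgebraicClosure (ZMod p)) p := charP_of_injective_algebraMap
    (algebraMap (ZMod p) (AlgebraicClosure (ZMod p))).injective p
  obtain ⟨t, ht, hsum⟩ := exists_extSum_eq (K := AlgebraicClosure (ZMod p)) hψ (F := F) (by
    rw [Ne, ZMod.natCast_eq_zero_iff]
    exact fun h => (Nat.le_of_dvd hF h).not_gt hFp)
  have hroot : ∀ ω ∈ t, ‖ω‖ ≤ √p := by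
    intro ω hω
    refine Real.le_sqrt_of_sq_le ?_
    rw [← norm_pow]
    obtain ⟨g, hg⟩ : ∃ g, g = F.natDegree * p := ⟨_, rfl⟩
    refine norm_le_of_norm_powerSum_le (t := t.map (· ^ 2)) (C := 2 * g + 1)
      (n₀ := g * g + 3 * g + 2) hp ?_ (Multiset.mem_map_of_mem _ hω)
    intro n hn
    have h1 := norm_extSum_le (K := AlgebraicClosure (ZMod p)) hψ hpd hg (s := n) (by omega)
      (lt_of_lt_of_le (by omega) (Nat.lt_pow_self hpp.one_lt).le)
    rw [hsum _ (by omega), norm_neg] at h1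
    rw [Multiset.map_map]
    simpa [Function.comp_def, ← pow_mul] using h1
  rw [← extSum_one (K := AlgebraicClosure (ZMod p)), hsum 1 one_pos, norm_neg]
  calc ‖(t.map (· ^ 1)).sum‖ ≤ (t.map (fun ω => ‖ω‖)).sum := by
        simpa using norm_multiset_sum_le t
    _ ≤ (t.map fun _ => √p).sum := Multiset.sum_map_le_sum_map _ _ hroot
    _ = _ := by
        rw [Multiset.map_const', Multiset.sum_replicate, ht, nsmul_eq_mul, Nat.cast_pred hF]

end WeilBound

section Completion

open ZMod

theorem natCast_mul_sum_mul_eq {N : ℕ} [NeZero N] (f : ZMod N → ℂ) (a : ℕ → ℂ) (s : Finset ℕ) :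
    N * ∑ u ∈ s, f u * a u =
      ∑ h : ZMod N, (∑ v ∈ s, a v * stdAddChar (-(h * (v : ZMod N)))) *
        ∑ z, f z * stdAddChar (h * z) := by
  have h1 : ∀ (v : ℕ) (z : ZMod N),
      ∑ h : ZMod N, stdAddChar (-(h * (v : ZMod N))) * stdAddChar (h * z) =
      if z = v then (N : ℂ) else 0 := by
    intro v z
    have h2 := AddChar.sum_mulShift (z - v) (isPrimitive_stdAddChar N)
    simp only [sub_eq_zero, ZMod.card] at h2
    rw [Nat.cast_ite, Nat.cast_zero] at h2
    rw [← h2]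
    refine Finset.sum_congr rfl fun h _ => ?_
    rw [← AddChar.map_add_eq_mul]
    congr 1
    ring
  symm
  calc _ = ∑ h : ZMod N, ∑ v ∈ s, ∑ z, a v * f z *
        (stdAddChar (-(h * (v : ZMod N))) * stdAddChar (h * z)) := by
        refine Finset.sum_congr rfl fun h _ => ?_
        rw [Finset.sum_mul_sum]
        refine Finset.sum_congr rfl fun v _ => Finset.sum_congr rfl fun z _ => ?_
        ring
    _ = ∑ v ∈ s, ∑ z, a v * f z *
        ∑ h : ZMod N, stdAddChar (-(h * (v : ZMod N))) * stdAddChar (h * z) := by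
        rw [Finset.sum_comm]
        refine Finset.sum_congr rfl fun v _ => ?_
        rw [Finset.sum_comm]
        simp_rw [Finset.mul_sum]
    _ = _ := by
        rw [Finset.mul_sum]
        refine Finset.sum_congr rfl fun v _ => ?_
        simp only [h1, mul_ite, mul_zero, Finset.sum_ite_eq', Finset.mem_univ,
          if_true]
        ring

theorem sum_zmod_eq_sum_range {N : ℕ} [NeZero N] {M : Type*} [AddCommMonoid M] (G : ZMod N → M) :
    ∑ h, G h = ∑ j ∈ Finset.range N, G j := by
  refine Finset.sum_bij (fun h _ => h.val) ?_ ?_ ?_ ?_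
  · intro h _
    exact Finset.mem_range.mpr h.val_lt
  · intro h _ h' _ e
    exact ZMod.val_injective N e
  · intro j hj
    exact ⟨j, Finset.mem_univ _, ZMod.val_cast_of_lt (Finset.mem_range.mp hj)⟩
  · intro h _
    rw [ZMod.natCast_zmod_val]

theorem mul_one_sub_le_sin_pi_mul {x : ℝ} (hx0 : 0 ≤ x) (hx1 : x ≤ 1) :
    2 * (x * (1 - x)) ≤ Real.sin (Real.pi * x) := by
  have hπ := Real.pi_pos
  have key : ∀ y : ℝ, 0 ≤ y → y ≤ 1 / 2 → 2 * (y * (1 - y)) ≤ Real.sin (Real.pi * y) := by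
    intro y hy0 hy1
    have h1 := Real.mul_le_sin (x := Real.pi * y) (by positivity) (by nlinarith)
    have h2 : 2 / Real.pi * (Real.pi * y) = 2 * y := by field_simp
    nlinarith
  rcases le_total x (1 / 2) with h | h
  · exact key x hx0 h
  · have := key (1 - x) (by linarith) (by linarith)
    rw [mul_sub Real.pi, mul_one, Real.sin_pi_sub] at this
    linarith

theorem norm_sum_exp_le {x : ℝ} (hx0 : 0 < x) (hx1 : x < 1) (N : ℕ) :
    ‖∑ v ∈ Finset.Icc 1 N, Complex.exp (2 * Real.pi * Complex.I * ((-x : ℝ) : ℂ) * v)‖ ≤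
      (1 / x + 1 / (1 - x)) / 2 := by
  set z := Complex.exp (Complex.I * ((-(2 * Real.pi * x) : ℝ) : ℂ)) with hz
  have hsum : ∑ v ∈ Finset.Icc 1 N, Complex.exp (2 * Real.pi * Complex.I * ((-x : ℝ) : ℂ) * v) =
      z * ∑ v ∈ Finset.range N, z ^ v := by
    have hIcc : Finset.Icc 1 N = Finset.Ico 1 (N + 1) := by
      ext
      simp only [Finset.mem_Icc, Finset.mem_Ico]
      omega
    rw [Finset.mul_sum, hIcc, Finset.sum_Ico_eq_sum_range, Nat.add_sub_cancel]
    refine Finset.sum_congr rfl fun v _ => ?_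
    rw [hz, ← Complex.exp_nat_mul, ← Complex.exp_add]
    congr 1
    push_cast
    ring
  have hznorm : ‖z‖ = 1 := by
    rw [hz, mul_comm]
    exact Complex.norm_exp_ofReal_mul_I _
  have hsin := mul_one_sub_le_sin_pi_mul hx0.le hx1.le
  have hpos : 0 < 2 * (x * (1 - x)) := by nlinarith [mul_pos hx0 (sub_pos.mpr hx1)]
  have hden : 2 * (2 * (x * (1 - x))) ≤ ‖z - 1‖ := by
    rw [hz, Complex.norm_exp_I_mul_ofReal_sub_one,
      show -(2 * Real.pi * x) / 2 = -(Real.pi * x) by ring, Real.sin_neg, Real.norm_eq_abs,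
      mul_neg, abs_neg]
    exact le_trans (by linarith) (le_abs_self _)
  have hz1 : z ≠ 1 := by
    intro h
    rw [h, sub_self, norm_zero] at hden
    linarith
  rw [hsum, norm_mul, hznorm, one_mul, geom_sum_eq hz1, norm_div]
  have hnum : ‖z ^ N - 1‖ ≤ 2 := by
    refine (norm_sub_le _ _).trans ?_
    rw [norm_pow, hznorm, one_pow, norm_one]
    norm_num
  have h1x : 0 < 1 - x := sub_pos.mpr hx1
  calc ‖z ^ N - 1‖ / ‖z - 1‖ ≤ 2 / (2 * (2 * (x * (1 - x)))) :=
        div_le_div₀ (by norm_num) hnum (by linarith) hden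
    _ = _ := by
        field_simp
        ring

theorem norm_sum_exp_le_card (β : ℝ) (N : ℕ) :
    ‖∑ v ∈ Finset.Icc 1 N, Complex.exp (2 * Real.pi * Complex.I * (β : ℂ) * v)‖ ≤ N := by
  refine (norm_sum_le _ _).trans (le_of_eq ?_)
  rw [Finset.sum_congr rfl (g := fun _ => (1 : ℝ))]
  · simp
  · intro v _
    rw [show 2 * Real.pi * Complex.I * (β : ℂ) * v = ((2 * Real.pi * β * v : ℝ) : ℂ) * Complex.I by
      push_cast; ring]
    exact Complex.norm_exp_ofReal_mul_I _

theorem sum_norm_fourier_exp_le {N : ℕ} [NeZero N] (α : ℝ) :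
    ∑ h : ZMod N, ‖∑ v ∈ Finset.Icc 1 N,
      Complex.exp (2 * Real.pi * Complex.I * (α : ℂ) * v) * stdAddChar (-(h * (v : ZMod N)))‖ ≤
      N * (3 + Real.log N) := by
  have hN : (0 : ℝ) < N := by exact_mod_cast Nat.pos_of_ne_zero (NeZero.ne N)
  set h₀ := ⌊α * N⌋ with hh₀
  set θ := α - h₀ / N with hθ
  have hθ0 : 0 ≤ θ := by
    rw [hθ, sub_nonneg, div_le_iff₀ hN]
    exact Int.floor_le _
  have hθ1 : θ < 1 / N := by
    have h1 := Int.lt_floor_add_one (α * N)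
    rw [hθ, sub_lt_iff_lt_add, ← add_div, lt_div_iff₀ hN]
    linarith
  rw [← Equiv.sum_comp (Equiv.addLeft (h₀ : ZMod N)), sum_zmod_eq_sum_range]
  have hterm : ∀ j : ℕ, (∑ v ∈ Finset.Icc 1 N, Complex.exp (2 * Real.pi * Complex.I * (α : ℂ) * v) *
      stdAddChar (-(Equiv.addLeft (h₀ : ZMod N) (j : ZMod N) * (v : ZMod N)))) =
      ∑ v ∈ Finset.Icc 1 N,
        Complex.exp (2 * Real.pi * Complex.I * ((-(j / N - θ) : ℝ) : ℂ) * v) := by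
    intro j
    refine Finset.sum_congr rfl fun v _ => ?_
    have h1 : -(Equiv.addLeft (h₀ : ZMod N) (j : ZMod N) * (v : ZMod N)) =
        ((-((h₀ + j) * v) : ℤ) : ZMod N) := by
      push_cast
      rfl
    rw [h1, stdAddChar_coe, ← Complex.exp_add]
    congr 1
    rw [hθ]
    have : (N : ℂ) ≠ 0 := by exact_mod_cast hN.ne'
    push_cast
    field_simp
    ring
  simp only [hterm]
  set G : ℕ → ℝ := fun j => ‖∑ v ∈ Finset.Icc 1 N,
    Complex.exp (2 * Real.pi * Complex.I * ((-(j / N - θ) : ℝ) : ℂ) * v)‖ with hG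
  change ∑ j ∈ Finset.range N, G j ≤ _
  have hG1 : ∀ j, G j ≤ N := fun j => norm_sum_exp_le_card _ N
  have hG2 : ∀ i m, N = m + 2 → i < m →
      G (2 + i) ≤ N / 2 * (((i : ℝ) + 1)⁻¹ + (((m - 1 - i : ℕ) : ℝ) + 1)⁻¹) := by
    intro i m hm hi
    have hNm : (N : ℝ) = m + 2 := by exact_mod_cast hm
    have him : (i : ℝ) + 1 ≤ m := by exact_mod_cast hi
    have hi0 : (0 : ℝ) ≤ i := Nat.cast_nonneg i
    have hlow : ((i : ℝ) + 1) / N ≤ ((2 + i : ℕ) : ℝ) / N - θ := by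
      have : ((2 + i : ℕ) : ℝ) / N = (i + 1) / N + 1 / N := by push_cast; ring
      linarith
    have hup : ((m : ℝ) - i) / N ≤ 1 - (((2 + i : ℕ) : ℝ) / N - θ) := by
      have : ((m : ℝ) - i) / N = 1 - ((2 + i : ℕ) : ℝ) / N := by
        push_cast
        field_simp
        rw [hNm]
        ring
      linarith
    have hl0 : 0 < ((i : ℝ) + 1) / N := by positivity
    have hu0 : 0 < ((m : ℝ) - i) / N := div_pos (by linarith) hN
    refine (norm_sum_exp_le (hl0.trans_le hlow) (by linarith) N).trans ?_
    have hl := one_div_le_one_div_of_le hl0 hlow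
    have hu := one_div_le_one_div_of_le hu0 hup
    have hcast : (((m - 1 - i : ℕ) : ℝ) + 1) = m - i := by
      rw [Nat.cast_sub (by omega), Nat.cast_sub (by omega)]
      push_cast
      ring
    rw [one_div_div] at hl hu
    rw [hcast, mul_add, ← div_eq_mul_inv, ← div_eq_mul_inv, div_right_comm,
      div_right_comm (N : ℝ) 2]
    linarith
  have hlog : 0 ≤ Real.log N := Real.log_natCast_nonneg N
  obtain hN1 | ⟨m, hm⟩ : N = 1 ∨ ∃ m, N = m + 2 := by
    rcases N with _ | _ | m
    · exact absurd rfl (NeZero.ne 0)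
    · exact Or.inl rfl
    · exact Or.inr ⟨m, rfl⟩
  · have := hG1 0
    rw [show Finset.range N = {0} by rw [hN1]; rfl, Finset.sum_singleton]
    nlinarith
  · have hharm : ∑ i ∈ Finset.range m, ((i : ℝ) + 1)⁻¹ ≤ 1 + Real.log N := by
      have h1 := harmonic_le_one_add_log m
      have h2 : Real.log m ≤ Real.log N := by
        rcases Nat.eq_zero_or_pos m with h | h
        · simpa [h] using hlog
        · exact Real.log_le_log (by exact_mod_cast h) (by exact_mod_cast (by omega : m ≤ N))
      rw [harmonic] at h1
      push_cast at h1
      linarith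
    have hharm' : ∑ i ∈ Finset.range m, (((m - 1 - i : ℕ) : ℝ) + 1)⁻¹ =
        ∑ i ∈ Finset.range m, ((i : ℝ) + 1)⁻¹ :=
      Finset.sum_range_reflect (fun i : ℕ => ((i : ℝ) + 1)⁻¹) m
    have hsplit : ∑ j ∈ Finset.range N, G j = G 0 + G 1 + ∑ i ∈ Finset.range m, G (2 + i) := by
      rw [show Finset.range N = Finset.range (2 + m) by rw [hm, add_comm],
        Finset.sum_range_add, Finset.sum_range_succ, Finset.sum_range_one]
    have htail := Finset.sum_le_sum fun i hi => hG2 i m hm (Finset.mem_range.mp hi)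
    rw [← Finset.mul_sum, Finset.sum_add_distrib, hharm'] at htail
    have := hG1 0
    have := hG1 1
    rw [hsplit]
    nlinarith

/-- Completion of a sum over residues twisted by a real frequency. -/
theorem norm_sum_mul_exp_le {N : ℕ} [NeZero N] {f : ZMod N → ℂ} {B : ℝ}
    (hB : ∀ h, ‖∑ z, f z * stdAddChar (h * z)‖ ≤ B) (α : ℝ) :
    ‖∑ u ∈ Finset.Icc 1 N, f u * Complex.exp (2 * Real.pi * Complex.I * (α : ℂ) * u)‖ ≤
      B * (3 + Real.log N) := by
  have hN : (0 : ℝ) < N := by exact_mod_cast Nat.pos_of_ne_zero (NeZero.ne N)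
  have hB0 : 0 ≤ B := (norm_nonneg _).trans (hB 0)
  refine le_of_mul_le_mul_left ?_ hN
  calc N * ‖∑ u ∈ Finset.Icc 1 N, f u * Complex.exp (2 * Real.pi * Complex.I * (α : ℂ) * u)‖
      = ‖N * ∑ u ∈ Finset.Icc 1 N,
          f u * Complex.exp (2 * Real.pi * Complex.I * (α : ℂ) * u)‖ := by
        rw [norm_mul, Complex.norm_natCast]
    _ ≤ ∑ h : ZMod N, ‖∑ v ∈ Finset.Icc 1 N,
          Complex.exp (2 * Real.pi * Complex.I * (α : ℂ) * v) *
            stdAddChar (-(h * (v : ZMod N)))‖ * B := by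
        rw [natCast_mul_sum_mul_eq f
          (fun u => Complex.exp (2 * Real.pi * Complex.I * (α : ℂ) * u))]
        refine (norm_sum_le _ _).trans (Finset.sum_le_sum fun h _ => ?_)
        rw [norm_mul]
        exact mul_le_mul_of_nonneg_left (hB h) (norm_nonneg _)
    _ ≤ N * (3 + Real.log N) * B := by
        rw [← Finset.sum_mul]
        exact mul_le_mul_of_nonneg_right (sum_norm_fourier_exp_le α) hB0
    _ = _ := by ring

end Completion

theorem eZMod_eq_stdAddChar {N : ℕ} [NeZero N] (z : ZMod N) : eZMod N z = ZMod.stdAddChar z := by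
  conv_rhs => rw [← ZMod.natCast_zmod_val z]
  rw [eZMod, ← Int.cast_natCast (R := ZMod N), ZMod.stdAddChar_coe, Int.cast_natCast]

theorem sqrt_mul_three_add_log_le {x : ℝ} (hx : 1 ≤ x) :
    √x * (3 + Real.log x) ≤ 9 * x ^ ((2 : ℝ) / 3) := by
  have hx0 : 0 < x := by linarith
  have h1 : Real.log x ≤ 6 * x ^ ((1 : ℝ) / 6) := by
    have := Real.log_le_rpow_div hx0.le (ε := 1 / 6) (by norm_num)
    linarith
  have h2 : 1 ≤ x ^ ((1 : ℝ) / 6) := Real.one_le_rpow hx (by norm_num)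
  have h3 : √x * x ^ ((1 : ℝ) / 6) = x ^ ((2 : ℝ) / 3) := by
    rw [Real.sqrt_eq_rpow, ← Real.rpow_add hx0]
    norm_num
  rw [← h3]
  nlinarith [Real.sqrt_nonneg x]

/-- A mixed exponential sum is bounded by Weil's bound up to a logarithm. -/
theorem norm_sum_eZMod_mul_eInt_le {p : ℕ} (hp : p.Prime) {F : Polynomial (ZMod p)}
    (hF : 2 ≤ F.natDegree) (hFp : F.natDegree < p) (n : ℕ) (k : ℤ) :
    ‖∑ u ∈ Finset.Icc 1 p, eZMod p (F.eval (u : ZMod p)) * eInt n (k * u)‖ ≤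
      (F.natDegree - 1) * √p * (3 + Real.log p) := by
  have : Fact p.Prime := ⟨hp⟩
  have hψ : ZMod.stdAddChar (N := p) ≠ 1 := by
    simpa [AddChar.mulShift_one] using ZMod.isPrimitive_stdAddChar p one_ne_zero
  have hB : ∀ h : ZMod p, ‖∑ z, ZMod.stdAddChar (F.eval z) * ZMod.stdAddChar (h * z)‖ ≤
      (F.natDegree - 1) * √p := by
    intro h
    have hdeg : (F + Polynomial.C h * Polynomial.X).natDegree = F.natDegree :=
      Polynomial.natDegree_add_eq_left_of_natDegree_lt
        ((Polynomial.natDegree_C_mul_le h _).trans_lt (by rw [Polynomial.natDegree_X]; omega))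
    have h1 := norm_sum_addChar_eval_le hψ (F := F + Polynomial.C h * Polynomial.X) (by omega)
      (by omega)
    rw [hdeg] at h1
    simpa [AddChar.map_add_eq_mul] using h1
  refine le_trans (le_of_eq ?_) (norm_sum_mul_exp_le hB (k / n : ℝ))
  congr 1
  refine Finset.sum_congr rfl fun u _ => ?_
  rw [eZMod_eq_stdAddChar, eInt]
  congr 2
  push_cast
  ring

/-- For every `d ≥ 2` there is a constant `C_d > 0` such that for
every prime `p > d`, every polynomial `F ∈ F_p[X]` of degree exactly `d`, every
`n ≥ 1`, and every integer `k`,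
`|Σ_{u=1}^p e_p(F(u)) e_n(k u)| ≤ C_d p^{2/3}` if `d = 2` and
`≤ C_d p^{3/4}` if `d ≥ 3`. -/
theorem mixed_exponential_sum_bound
    (d : ℕ) (hd : 2 ≤ d) :
    ∃ C : ℝ, 0 < C ∧
      ∀ p : ℕ, p.Prime → d < p →
      ∀ F : Polynomial (ZMod p), F.natDegree = d →
      ∀ n : ℕ, 0 < n → ∀ k : ℤ,
        ‖∑ u ∈ Finset.Icc 1 p, eZMod p (F.eval (u : ZMod p)) * eInt n (k * u)‖ ≤
          if d = 2 then C * (p : ℝ) ^ ((2 : ℝ) / 3) else C * (p : ℝ) ^ ((3 : ℝ) / 4) := by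
  refine ⟨9 * d, by positivity, ?_⟩
  intro p hp hdp F hF n _ k
  subst hF
  have hp1 : (1 : ℝ) ≤ p := by exact_mod_cast hp.one_le
  have h1 : ‖∑ u ∈ Finset.Icc 1 p, eZMod p (F.eval (u : ZMod p)) * eInt n (k * u)‖ ≤
      9 * F.natDegree * (p : ℝ) ^ ((2 : ℝ) / 3) := by
    refine (norm_sum_eZMod_mul_eInt_le hp hd hdp n k).trans ?_
    have h2 := sqrt_mul_three_add_log_le hp1
    have h3 : 0 ≤ √p * (3 + Real.log p) := by
      have := Real.log_nonneg hp1
      positivity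
    have h4 : (0 : ℝ) ≤ F.natDegree := Nat.cast_nonneg _
    nlinarith
  split_ifs
  · exact h1
  · exact h1.trans (mul_le_mul_of_nonneg_left
      (Real.rpow_le_rpow_of_exponent_le hp1 (by norm_num)) (by positivity))
end
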